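/- Consider gradings of Monge type determined by subsets Σ of the simple roots α₁, …, α_ℓ (standard ordering). (a) For type B_ℓ with ℓ ≥ 4, every Monge grading with |Σ| = 3 is rigid, and the non-rigid Monge gradings of type B are exactly: B₂ with Σ = {α₂}, B₃ with Σ = {α₂, α₃}, B₃ with Σ = {α₁, α₂, α₃}, and B_ℓ with Σ = {α₁, α₂} for ℓ ≥ 2. (b) For type D_ℓ with ℓ ≥ 4, every Monge grading with |Σ| ≥ 3 is rigid, and, up to automorphisms of the Dynkin diagram, the non-rigid Monge gradings of type D_ℓ, ℓ ≥ 4, are exactly Σ = {α₁, α₂}. -/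

import Mathlib

open scoped RealInnerProductSpace BigOperators Classical

/-- A reduced crystallographic root system in a real inner product space,
together with a chosen base of simple roots and the coordinates of each
root with respect to the base. -/
structure RootSystemBase (V : Type*) [NormedAddCommGroup V] [InnerProductSpace ℝ V] where
  /-- the set of roots -/
  Δ : Finset V
  /-- the set of simple roots (the base) -/
  Δ0 : Finset V
  base_sub : Δ0 ⊆ Δ
  ne_zero : ∀ β ∈ Δ, β ≠ (0 : V)
  indep : LinearIndependent ℝ (fun a : ↥Δ0 => (a : V))
  neg_mem : ∀ β ∈ Δ, -β ∈ Δ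
  /-- `coeff β α` is the coefficient `n_α` of the simple root `α` in `β = ∑ n_α • α` -/
  coeff : V → V → ℤ
  coeff_spec : ∀ β ∈ Δ, β = ∑ α ∈ Δ0, (coeff β α : ℝ) • α
  coeff_sign : ∀ β ∈ Δ, (∀ α ∈ Δ0, 0 ≤ coeff β α) ∨ (∀ α ∈ Δ0, coeff β α ≤ 0)
  crystal : ∀ α ∈ Δ, ∀ β ∈ Δ, ∃ k : ℤ, 2 * ⟪β, α⟫ / ⟪α, α⟫ = (k : ℝ)
  reflect_mem : ∀ α ∈ Δ, ∀ β ∈ Δ, β - (2 * ⟪β, α⟫ / ⟪α, α⟫) • α ∈ Δ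
  reduced : ∀ α ∈ Δ, (2 : ℝ) • α ∉ Δ

namespace RootSystemBase

variable {V : Type*} [NormedAddCommGroup V] [InnerProductSpace ℝ V]

variable (R : RootSystemBase V)

/-- The height `ht_Σ(β)` of a root `β` relative to a subset `Sg` of the simple roots. -/
def ht (Sg : Finset V) (β : V) : ℤ := ∑ α ∈ Sg, R.coeff β α

/-- positive roots -/
def IsPos (β : V) : Prop := β ∈ R.Δ ∧ ∀ α ∈ R.Δ0, 0 ≤ R.coeff β α

/-- negative roots -/
def IsNeg (β : V) : Prop := β ∈ R.Δ ∧ ∀ α ∈ R.Δ0, R.coeff β α ≤ 0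

/-- Irreducibility of the root system (the Dynkin diagram is connected); this is
equivalent to the corresponding complex Lie algebra being simple. -/
def Irred : Prop :=
  ¬ ∃ S : Finset V, S ⊆ R.Δ0 ∧ S.Nonempty ∧ S ≠ R.Δ0 ∧
      ∀ a ∈ S, ∀ b ∈ R.Δ0, b ∉ S → ⟪a, b⟫ = 0

/-- Adjacency of two (simple) roots in the Dynkin diagram. -/
def Adj (a b : V) : Prop := a ≠ b ∧ ⟪a, b⟫ ≠ 0

end RootSystemBase

namespace RootSystemBase

variable {V : Type*} [NormedAddCommGroup V] [InnerProductSpace ℝ V]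

/-- The Cartan pairing `⟨a, b⟩ = 2(a,b)/(b,b)`. -/
noncomputable def cInt (a b : V) : ℝ := 2 * ⟪a, b⟫ / ⟪b, b⟫

end RootSystemBase

namespace RootSystemBase

variable {V : Type*} [NormedAddCommGroup V] [InnerProductSpace ℝ V]

/-- The reflection `s_a` in the root `a`:  `s_a(v) = v - ⟨v, a⟩ a`. -/
noncomputable def refl (a v : V) : V := v - cInt v a • a

variable (R : RootSystemBase V)

/-- `θ` is the highest root. -/
def IsHighest (θ : V) : Prop :=
  θ ∈ R.Δ ∧ ∀ β ∈ R.Δ, ∀ α ∈ R.Δ0, R.coeff β α ≤ R.coeff θ α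

/-- `Δ_σ = σ(Δ⁻) ∩ Δ⁺` for the length-two Weyl group element `σ = s_a ∘ s_b`;
equivalently the positive roots mapped to negative roots by `σ⁻¹ = s_b ∘ s_a`. -/
noncomputable def Dsig (a b : V) : Finset V :=
  R.Δ.filter (fun β => R.IsPos β ∧ R.IsNeg (refl b (refl a β)))

/-- The grading determined by `Sg` is *non-rigid*:  there is `σ = s_a ∘ s_b ∈ W²_Σ`
(`a ≠ b` simple, `Δ_σ ⊆ Δ⁺_Σ`, `|Δ_σ| = 2`) whose harmonic representative has
positive homogeneity weight, i.e.
`⟨θ, a⟩ + (⟨θ, b⟩ + 1)·ht_Σ(s_a(b)) ≥ ht_Σ(θ)`.  By Kostant's theorem this is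
equivalent to the nonvanishing of `H²(𝔤₋, 𝔤)` in some positive homogeneity weight. -/
noncomputable def NonRigid (Sg : Finset V) (θ : V) : Prop :=
  ∃ a ∈ R.Δ0, ∃ b ∈ R.Δ0, a ≠ b ∧
    (R.Dsig a b).card = 2 ∧ (∀ β ∈ R.Dsig a b, 0 < R.ht Sg β) ∧
    (R.ht Sg θ : ℝ) ≤ cInt θ a + (cInt θ b + 1) * (R.ht Sg (refl a b) : ℝ)

end RootSystemBase

namespace RootSystemBase

variable {V : Type*} [NormedAddCommGroup V] [InnerProductSpace ℝ V]

/-- `R` is the root system whose simple roots are `α 1, …, α ℓ` (standard ordering)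
with Cartan matrix `M`, i.e. `M i j = ⟨αᵢ, αⱼ^∨⟩`. -/
def IsTypeOf (R : RootSystemBase V) (ℓ : ℕ) (α : ℕ → V) (M : ℕ → ℕ → ℝ) : Prop :=
  Set.InjOn α (Set.Icc 1 ℓ) ∧ R.Δ0 = (Finset.Icc 1 ℓ).image α ∧
    ∀ i ∈ Finset.Icc 1 ℓ, ∀ j ∈ Finset.Icc 1 ℓ, cInt (α i) (α j) = M i j

/-- The Cartan matrix of type `Aₗ`. -/
def matA (i j : ℕ) : ℝ :=
  if i = j then 2 else if i + 1 = j ∨ j + 1 = i then -1 else 0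

/-- The Cartan matrix of type `Bₗ` (with `α_ℓ` the short simple root). -/
def matB (ℓ i j : ℕ) : ℝ :=
  if i = j then 2
  else if i + 1 = j then (if j = ℓ then -2 else -1)
  else if j + 1 = i then -1 else 0

/-- The Cartan matrix of type `Cₗ` (with `α_ℓ` the long simple root). -/
def matC (ℓ i j : ℕ) : ℝ :=
  if i = j then 2
  else if i + 1 = j then -1
  else if j + 1 = i then (if i = ℓ then -2 else -1) else 0

/-- The Cartan matrix of type `Dₗ`. -/
def matD (ℓ i j : ℕ) : ℝ :=
  if i = j then 2
  else if ((i + 1 = j ∨ j + 1 = i) ∧ ¬(i = ℓ - 1 ∧ j = ℓ) ∧ ¬(j = ℓ - 1 ∧ i = ℓ)) ∨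
      (i = ℓ - 2 ∧ j = ℓ) ∨ (j = ℓ - 2 ∧ i = ℓ) then -1 else 0

/-- The Cartan matrix of type `G₂` (with `α₁` the short simple root, Humphreys'
labelling). -/
def matG2 (i j : ℕ) : ℝ :=
  if i = j then 2 else if i = 1 ∧ j = 2 then -1 else if i = 2 ∧ j = 1 then -3 else 0

/-- The Cartan matrix of type `F₄` (Humphreys' labelling). -/
def matF4 (i j : ℕ) : ℝ :=
  if i = j then 2
  else if i = 2 ∧ j = 3 then -2
  else if i + 1 = j ∨ j + 1 = i then -1 else 0

/-- Adjacency in the Dynkin diagram of type `E_ℓ` (`ℓ = 6, 7, 8`), Humphreys'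
labelling: the node `2` is attached to the node `4` of the chain `1,3,4,…,ℓ`. -/
def eAdj (ℓ i j : ℕ) : Prop :=
  (min i j, max i j) ∈
    ([(1,3),(3,4),(4,5),(5,6),(2,4),(6,7),(7,8)].filter (fun p => p.2 ≤ ℓ))

/-- The Cartan matrix of type `E_ℓ` (`ℓ = 6, 7, 8`), Humphreys' labelling. -/
noncomputable def matE (ℓ i j : ℕ) : ℝ :=
  if i = j then 2 else if eAdj ℓ i j then -1 else 0

end RootSystemBase

/-- The root space decomposition data of a complex semisimple Lie algebra `L` with
root system `base`: a Cartan subalgebra `H`, one-dimensional root spaces `rs β`,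
and the standard bracket relations among them. -/
structure GradedLieData (V : Type*) [NormedAddCommGroup V] [InnerProductSpace ℝ V]
    (L : Type*) [LieRing L] [LieAlgebra ℂ L] where
  /-- the underlying root system with base -/
  base : RootSystemBase V
  /-- the Cartan subalgebra -/
  H : Submodule ℂ L
  /-- the root spaces -/
  rs : V → Submodule ℂ L
  rs_dim : ∀ β ∈ base.Δ, Module.finrank ℂ ↥(rs β) = 1
  rs_bot : ∀ v : V, v ∉ base.Δ → rs v = ⊥
  sup_eq_top : H ⊔ (⨆ β ∈ base.Δ, rs β) = ⊤
  h_indep : Disjoint H (⨆ β ∈ base.Δ, rs β)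
  rs_indep : ∀ β ∈ base.Δ, Disjoint (rs β) (H ⊔ ⨆ γ ∈ base.Δ.erase β, rs γ)
  /-- `toH v` is the element of the Cartan subalgebra representing `v` via the Killing
  form -/
  toH : V → L
  toH_mem : ∀ v : V, toH v ∈ H
  toH_add : ∀ u v : V, toH (u + v) = toH u + toH v
  H_span : H = Submodule.span ℂ (toH '' ↑base.Δ0)
  br_toH : ∀ v : V, ∀ β ∈ base.Δ, ∀ x ∈ rs β, ⁅toH v, x⁆ = ((⟪β, v⟫ : ℝ) : ℂ) • x
  br_h_h : ∀ h ∈ H, ∀ h' ∈ H, ⁅h, h'⁆ = (0 : L)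
  br_h_rs : ∀ β ∈ base.Δ, ∀ h ∈ H, ∀ x ∈ rs β, ⁅h, x⁆ ∈ rs β
  br_rs_mem : ∀ β ∈ base.Δ, ∀ γ ∈ base.Δ, β + γ ∈ base.Δ →
      ∀ x ∈ rs β, ∀ y ∈ rs γ, ⁅x, y⁆ ∈ rs (β + γ)
  br_rs_zero : ∀ β ∈ base.Δ, ∀ γ ∈ base.Δ, β + γ ∉ base.Δ → β + γ ≠ 0 →
      ∀ x ∈ rs β, ∀ y ∈ rs γ, ⁅x, y⁆ = (0 : L)
  br_rs_opp : ∀ β ∈ base.Δ, ∀ x ∈ rs β, ∀ y ∈ rs (-β),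
      ⁅x, y⁆ ∈ Submodule.span ℂ ({toH β} : Set L)
  br_nondeg : ∀ β ∈ base.Δ, ∀ γ ∈ base.Δ, β + γ ∈ base.Δ →
      ∀ x ∈ rs β, ∀ y ∈ rs γ, ⁅x, y⁆ = (0 : L) → x = 0 ∨ y = 0

namespace GradedLieData

variable {V : Type*} [NormedAddCommGroup V] [InnerProductSpace ℝ V]
variable {L : Type*} [LieRing L] [LieAlgebra ℂ L]

variable (G : GradedLieData V L)

/-- The grading component `𝔤ⱼ` of the grading of `L` determined by the subset `Sg`
of the simple roots. -/
def g (Sg : Finset V) (j : ℤ) : Submodule ℂ L :=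
  if j = 0 then G.H ⊔ ⨆ β ∈ G.base.Δ.filter (fun β => G.base.ht Sg β = 0), G.rs β
  else ⨆ β ∈ G.base.Δ.filter (fun β => G.base.ht Sg β = j), G.rs β

/-- The grading of `L` determined by `Sg` is of *Monge type*: the component `𝔤₋₁`
contains a nonzero abelian subalgebra `Y` of codimension one with
`dim 𝔤₋₂ = dim Y`. -/
def Monge (Sg : Finset V) : Prop :=
  ∃ Y : Submodule ℂ L, Y ≤ G.g Sg (-1) ∧ Y ≠ ⊥ ∧
    (∀ a ∈ Y, ∀ b ∈ Y, ⁅a, b⁆ = (0 : L)) ∧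
    Module.finrank ℂ ↥Y + 1 = Module.finrank ℂ ↥(G.g Sg (-1)) ∧
    Module.finrank ℂ ↥(G.g Sg (-2)) = Module.finrank ℂ ↥Y

end GradedLieData

namespace RootSystemBase

variable {V : Type*} [NormedAddCommGroup V] [InnerProductSpace ℝ V]

section general
variable (R : RootSystemBase V)

theorem coeff_unique {β : V} (hβ : β ∈ R.Δ) (c : V → ℝ)
    (h : β = ∑ a ∈ R.Δ0, c a • a) : ∀ a ∈ R.Δ0, (R.coeff β a : ℝ) = c a := by
  have h1 := R.coeff_spec β hβ
  have h2 : ∑ a ∈ R.Δ0, ((R.coeff β a : ℝ) - c a) • a = 0 := by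
    simp only [sub_smul, Finset.sum_sub_distrib]
    rw [← h1, ← h, sub_self]
  have h3 := R.indep
  have h4 := linearIndependent_iff'.1 h3 Finset.univ (fun a => (R.coeff β a : ℝ) - c a)
    (by rw [← h2]; exact Finset.sum_coe_sort R.Δ0 (fun a => ((R.coeff β a : ℝ) - c a) • a))
  intro a ha
  have := h4 ⟨a, ha⟩ (Finset.mem_univ _)
  exact sub_eq_zero.1 this

theorem coeff_add {β γ : V} (hβ : β ∈ R.Δ) (hγ : γ ∈ R.Δ) (h : β + γ ∈ R.Δ) :
    ∀ a ∈ R.Δ0, R.coeff (β + γ) a = R.coeff β a + R.coeff γ a := by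
  intro a ha
  have := R.coeff_unique h (fun a => (R.coeff β a : ℝ) + R.coeff γ a) (by
    simp only [add_smul, Finset.sum_add_distrib]
    rw [← R.coeff_spec β hβ, ← R.coeff_spec γ hγ]) a ha
  exact_mod_cast this

theorem coeff_neg {β : V} (hβ : β ∈ R.Δ) :
    ∀ a ∈ R.Δ0, R.coeff (-β) a = - R.coeff β a := by
  intro a ha
  have := R.coeff_unique (R.neg_mem β hβ) (fun a => -(R.coeff β a : ℝ)) (by
    simp only [neg_smul, Finset.sum_neg_distrib]
    rw [← R.coeff_spec β hβ]) a ha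
  exact_mod_cast this

theorem coeff_simple {b : V} (hb : b ∈ R.Δ0) :
    ∀ a ∈ R.Δ0, R.coeff b a = if a = b then 1 else 0 := by
  intro a ha
  have := R.coeff_unique (R.base_sub hb) (fun a => if a = b then (1 : ℝ) else 0) (by
    simp [ite_smul, hb]) a ha
  by_cases h : a = b
  · simp only [h, if_true] at this ⊢
    exact_mod_cast this
  · simp only [h, if_false] at this ⊢
    exact_mod_cast this

theorem ht_add {Sg : Finset V} (hS : Sg ⊆ R.Δ0) {β γ : V} (hβ : β ∈ R.Δ) (hγ : γ ∈ R.Δ)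
    (h : β + γ ∈ R.Δ) : R.ht Sg (β + γ) = R.ht Sg β + R.ht Sg γ := by
  unfold ht
  rw [← Finset.sum_add_distrib]
  exact Finset.sum_congr rfl fun a ha => R.coeff_add hβ hγ h a (hS ha)

theorem ht_neg {Sg : Finset V} (hS : Sg ⊆ R.Δ0) {β : V} (hβ : β ∈ R.Δ) :
    R.ht Sg (-β) = - R.ht Sg β := by
  unfold ht
  rw [← Finset.sum_neg_distrib]
  exact Finset.sum_congr rfl fun a ha => R.coeff_neg hβ a (hS ha)

theorem refl_mem {a β : V} (ha : a ∈ R.Δ) (hβ : β ∈ R.Δ) : refl a β ∈ R.Δ :=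
  R.reflect_mem a ha β hβ

theorem inner_self_pos {β : V} (hβ : β ∈ R.Δ) : (0 : ℝ) < ⟪β, β⟫ :=
  real_inner_self_pos.2 (R.ne_zero β hβ)

theorem cInt_self {a : V} (ha : a ∈ R.Δ) : cInt a a = 2 := by
  unfold cInt
  have := R.inner_self_pos ha
  field_simp

theorem inner_eq_cInt {a : V} (ha : a ∈ R.Δ) (β : V) : ⟪β, a⟫ = cInt β a * ⟪a, a⟫ / 2 := by
  unfold cInt
  have := R.inner_self_pos ha
  field_simp

theorem refl_refl {a : V} (ha : a ∈ R.Δ) (β : V) : refl a (refl a β) = β := by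
  have h := R.inner_self_pos ha
  have : cInt (refl a β) a = - cInt β a := by
    unfold refl cInt
    rw [inner_sub_left, inner_smul_left]
    simp only [conj_trivial]
    field_simp
    ring
  conv_lhs => rw [refl, this]
  unfold refl
  simp

theorem refl_self {a : V} (ha : a ∈ R.Δ) : refl a a = -a := by
  unfold refl
  rw [R.cInt_self ha, two_smul]; abel

theorem refl_neg (a β : V) : refl a (-β) = - refl a β := by
  unfold refl cInt
  rw [inner_neg_left]
  simp only [mul_neg, neg_div, neg_smul]
  abel

theorem norm_refl {a : V} (ha : a ∈ R.Δ) (β : V) : ⟪refl a β, refl a β⟫ = ⟪β, β⟫ := by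
  have h := R.inner_self_pos ha
  unfold refl
  rw [inner_sub_left, inner_sub_right, inner_sub_right, inner_smul_left, inner_smul_right,
    inner_smul_left, inner_smul_right, R.inner_eq_cInt ha β, real_inner_comm β a,
    R.inner_eq_cInt ha β]
  simp only [conj_trivial]
  ring

theorem coeff_refl {a β : V} (ha : a ∈ R.Δ0) (hβ : β ∈ R.Δ) :
    ∀ b ∈ R.Δ0, (R.coeff (refl a β) b : ℝ) = R.coeff β b - if b = a then cInt β a else 0 := by
  refine R.coeff_unique (R.refl_mem (R.base_sub ha) hβ)
    (fun b => (R.coeff β b : ℝ) - if b = a then cInt β a else 0) ?_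
  simp only [sub_smul, Finset.sum_sub_distrib, ite_smul, zero_smul]
  rw [← R.coeff_spec β hβ, Finset.sum_ite_eq' R.Δ0 a, if_pos ha]
  rfl

/-- a positive multiple of a simple root is the simple root -/
theorem eq_of_coeff_zero {a β : V} (ha : a ∈ R.Δ0) (hβ : β ∈ R.Δ)
    (hp : 0 ≤ R.coeff β a) (h : ∀ b ∈ R.Δ0, b ≠ a → R.coeff β b = 0) : β = a := by
  have h1 : β = (R.coeff β a : ℝ) • a := by
    conv_lhs => rw [R.coeff_spec β hβ]
    rw [Finset.sum_eq_single a]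
    · intro b hb hba
      rw [h b hb hba]; simp
    · intro h; exact absurd ha h
  have haD := R.base_sub ha
  have hpos := R.inner_self_pos haD
  have hbpos := R.inner_self_pos hβ
  obtain ⟨k, hk⟩ := R.crystal β hβ a haD
  set n := R.coeff β a with hn
  have hn0 : n ≠ 0 := by
    intro h0
    rw [h0] at h1
    simp at h1
    exact R.ne_zero β hβ h1
  have hn0' : (n : ℝ) ≠ 0 := by exact_mod_cast hn0
  rw [h1, inner_smul_left, inner_smul_right] at hk
  simp only [conj_trivial] at hk
  have : (2 : ℝ) = k * n := by
    field_simp at hk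
    linarith
  have h2 : (2 : ℤ) = k * n := by exact_mod_cast this
  have hn1 : 0 < n := lt_of_le_of_ne hp (Ne.symm hn0)
  have hle : n ≤ 2 := Int.le_of_dvd (by norm_num) ⟨k, by linarith⟩
  have : n = 1 ∨ n = 2 := by omega
  rcases this with h3 | h3
  · rw [h1, h3]; simp
  · exfalso
    apply R.reduced a haD
    rw [h3] at h1
    have : ((2 : ℤ) : ℝ) • a = (2 : ℝ) • a := by norm_num
    rw [← this, ← h1]; exact hβ

theorem eq_of_refl_neg {a β : V} (ha : a ∈ R.Δ0) (hβ : R.IsPos β) (hn : R.IsNeg (refl a β)) :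
    β = a := by
  apply R.eq_of_coeff_zero ha hβ.1 (hβ.2 a ha)
  intro b hb hba
  have h1 := R.coeff_refl ha hβ.1 b hb
  rw [if_neg hba, sub_zero] at h1
  have h1' : R.coeff (refl a β) b = R.coeff β b := by exact_mod_cast h1
  have := hn.2 b hb
  have := hβ.2 b hb
  omega

theorem pos_or_neg {β : V} (hβ : β ∈ R.Δ) : R.IsPos β ∨ R.IsNeg β := by
  rcases R.coeff_sign β hβ with h | h
  · exact Or.inl ⟨hβ, h⟩
  · exact Or.inr ⟨hβ, h⟩

theorem simple_pos {a : V} (ha : a ∈ R.Δ0) : R.IsPos a := by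
  refine ⟨R.base_sub ha, fun b hb => ?_⟩
  rw [R.coeff_simple ha b hb]; split_ifs <;> norm_num

theorem neg_of_pos {β : V} (h : R.IsPos β) : R.IsNeg (-β) := by
  refine ⟨R.neg_mem _ h.1, fun b hb => ?_⟩
  rw [R.coeff_neg h.1 b hb]; have := h.2 b hb; omega

theorem not_pos_neg {β : V} (h : R.IsPos β) (h' : R.IsNeg β) : False := by
  apply R.ne_zero β h.1
  rw [R.coeff_spec β h.1]
  apply Finset.sum_eq_zero
  intro a ha
  have h1 := h.2 a ha
  have h2 := h'.2 a ha
  have : R.coeff β a = 0 := by omega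
  rw [this]; simp

theorem pos_refl {a β : V} (ha : a ∈ R.Δ0) (hβ : R.IsPos β) (hne : β ≠ a) :
    R.IsPos (refl a β) := by
  rcases R.pos_or_neg (R.refl_mem (R.base_sub ha) hβ.1) with h | h
  · exact h
  · exact absurd (R.eq_of_refl_neg ha hβ h) hne

theorem neg_simple_neg {a b : V} (ha : a ∈ R.Δ0) (hb : b ∈ R.Δ0) (hne : a ≠ b) :
    R.IsNeg (refl b (-a)) := by
  rw [refl_neg]
  exact R.neg_of_pos (R.pos_refl hb (R.simple_pos ha) hne)

theorem Dsig_eq {a b : V} (ha : a ∈ R.Δ0) (hb : b ∈ R.Δ0) (hne : a ≠ b) :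
    R.Dsig a b = {a, refl a b} := by
  ext β
  simp only [Dsig, Finset.mem_filter, Finset.mem_insert, Finset.mem_singleton]
  constructor
  · rintro ⟨hβ, hp, hn⟩
    by_cases h : β = a
    · exact Or.inl h
    · right
      have h1 := R.pos_refl ha hp h
      have h2 := R.eq_of_refl_neg hb h1 hn
      rw [← h2, R.refl_refl (R.base_sub ha)]
  · rintro (h | h)
    · subst h
      refine ⟨R.base_sub ha, R.simple_pos ha, ?_⟩
      rw [R.refl_self (R.base_sub ha)]
      exact R.neg_simple_neg ha hb hne
    · subst h
      refine ⟨R.refl_mem (R.base_sub ha) (R.base_sub hb),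
        R.pos_refl ha (R.simple_pos hb) hne.symm, ?_⟩
      rw [R.refl_refl (R.base_sub ha), R.refl_self (R.base_sub hb)]
      exact R.neg_of_pos (R.simple_pos hb)

theorem ne_refl {a b : V} (ha : a ∈ R.Δ0) (hb : b ∈ R.Δ0) : a ≠ refl a b := by
  intro h
  have h1 : refl a a = refl a (refl a b) := by rw [← h]
  rw [R.refl_refl (R.base_sub ha), R.refl_self (R.base_sub ha)] at h1
  apply R.not_pos_neg (R.simple_pos hb)
  rw [← h1]
  exact R.neg_of_pos (R.simple_pos ha)

theorem nonRigid_iff (Sg : Finset V) (θ : V) : R.NonRigid Sg θ ↔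
    ∃ a ∈ R.Δ0, ∃ b ∈ R.Δ0, a ≠ b ∧ 0 < R.ht Sg a ∧ 0 < R.ht Sg (refl a b) ∧
      (R.ht Sg θ : ℝ) ≤ cInt θ a + (cInt θ b + 1) * (R.ht Sg (refl a b) : ℝ) := by
  unfold NonRigid
  constructor
  · rintro ⟨a, ha, b, hb, hne, -, h2, h3⟩
    rw [R.Dsig_eq ha hb hne] at h2
    exact ⟨a, ha, b, hb, hne, h2 a (by simp), h2 _ (by simp), h3⟩
  · rintro ⟨a, ha, b, hb, hne, h1, h2, h3⟩
    refine ⟨a, ha, b, hb, hne, ?_, ?_, h3⟩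
    · rw [R.Dsig_eq ha hb hne, Finset.card_pair (R.ne_refl ha hb)]
    · rw [R.Dsig_eq ha hb hne]
      intro β hβ
      simp only [Finset.mem_insert, Finset.mem_singleton] at hβ
      rcases hβ with h | h <;> rw [h] <;> assumption

theorem norm_le_aux (C : ℝ) (hC : ∀ a ∈ R.Δ0, ⟪a, a⟫ ≤ C) (n : ℕ) :
    ∀ β, R.IsPos β → R.ht R.Δ0 β ≤ n → ⟪β, β⟫ ≤ C := by
  induction n with
  | zero =>
    intro β hβ hn
    exfalso
    apply R.not_pos_neg hβ
    refine ⟨hβ.1, ?_⟩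
    intro a ha
    have : R.coeff β a ≤ R.ht R.Δ0 β :=
      Finset.single_le_sum (f := fun a => R.coeff β a) (fun b hb => hβ.2 b hb) ha
    push_cast at hn
    omega
  | succ n ih =>
    intro β hβ hn
    have hbpos := R.inner_self_pos hβ.1
    have hex : ∃ a ∈ R.Δ0, 0 < ⟪β, a⟫ := by
      by_contra hcon
      push Not at hcon
      have : ⟪β, β⟫ ≤ 0 := by
        conv_lhs => rw [show ⟪β, β⟫ = ⟪β, ∑ a ∈ R.Δ0, (R.coeff β a : ℝ) • a⟫ from by
          rw [← R.coeff_spec β hβ.1]]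
        rw [inner_sum]
        apply Finset.sum_nonpos
        intro a ha
        rw [inner_smul_right]
        have h1 : (0 : ℝ) ≤ R.coeff β a := by exact_mod_cast hβ.2 a ha
        exact mul_nonpos_of_nonneg_of_nonpos h1 (hcon a ha)
      linarith
    obtain ⟨a, ha, hpos⟩ := hex
    by_cases hba : β = a
    · rw [hba]; exact hC a ha
    · have h1 := R.pos_refl ha hβ hba
      rw [← R.norm_refl (R.base_sub ha)]
      apply ih _ h1
      have hcp : 0 < cInt β a := by
        have := R.inner_self_pos (R.base_sub ha)
        unfold cInt; positivity
      have hlt : (R.ht R.Δ0 (refl a β) : ℝ) < R.ht R.Δ0 β := by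
        unfold ht
        push_cast
        rw [Finset.sum_congr rfl (fun b hb => R.coeff_refl ha hβ.1 b hb)]
        rw [Finset.sum_sub_distrib, Finset.sum_ite_eq' R.Δ0 a, if_pos ha]
        linarith
      have hlt' : R.ht R.Δ0 (refl a β) < R.ht R.Δ0 β := by exact_mod_cast hlt
      push_cast at hn
      omega

theorem norm_le (C : ℝ) (hC : ∀ a ∈ R.Δ0, ⟪a, a⟫ ≤ C) {β : V} (hβ : R.IsPos β) :
    ⟪β, β⟫ ≤ C :=
  R.norm_le_aux C hC (R.ht R.Δ0 β).toNat β hβ (Int.self_le_toNat _)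

theorem highest_dominant {θ : V} (hθ : R.IsHighest θ) {a : V} (ha : a ∈ R.Δ0) :
    0 ≤ ⟪θ, a⟫ := by
  have h1 := R.coeff_refl ha hθ.1 a ha
  have h2 := hθ.2 _ (R.refl_mem (R.base_sub ha) hθ.1) a ha
  have h2' : (R.coeff (refl a θ) a : ℝ) ≤ R.coeff θ a := by exact_mod_cast h2
  rw [if_pos rfl] at h1
  have h3 : 0 ≤ cInt θ a := by linarith
  have := R.inner_self_pos (R.base_sub ha)
  rw [R.inner_eq_cInt (R.base_sub ha)]
  positivity

theorem highest_pos {θ : V} (hθ : R.IsHighest θ) : R.IsPos θ := by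
  refine ⟨hθ.1, fun a ha => ?_⟩
  have := hθ.2 a (R.base_sub ha) a ha
  rw [R.coeff_simple ha a ha, if_pos rfl] at this
  omega

theorem highest_eq {θ η : V} (hθ : R.IsHighest θ) (hη : η ∈ R.Δ)
    (hdom : ∀ a ∈ R.Δ0, 0 ≤ ⟪η, a⟫) (hnorm : ∀ a ∈ R.Δ0, ⟪a, a⟫ ≤ ⟪η, η⟫) : θ = η := by
  have h1 := R.norm_le _ hnorm (R.highest_pos hθ)
  have hd : θ - η = ∑ a ∈ R.Δ0, ((R.coeff θ a : ℝ) - R.coeff η a) • a := by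
    simp only [sub_smul, Finset.sum_sub_distrib]
    rw [← R.coeff_spec θ hθ.1, ← R.coeff_spec η hη]
  have key : ∀ v : V, (∀ a ∈ R.Δ0, 0 ≤ ⟪v, a⟫) → 0 ≤ ⟪v, θ - η⟫ := by
    intro v hv
    rw [hd, inner_sum]
    apply Finset.sum_nonneg
    intro a ha
    rw [inner_smul_right]
    have h2 : (R.coeff η a : ℝ) ≤ R.coeff θ a := by exact_mod_cast hθ.2 η hη a ha
    exact mul_nonneg (by linarith) (hv a ha)
  have k1 := key θ (fun a ha => R.highest_dominant hθ ha)
  have k2 := key η hdom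
  rw [inner_sub_right] at k1 k2
  have hc := real_inner_comm θ η
  have : ⟪θ - η, θ - η⟫ ≤ 0 := by
    rw [inner_sub_left, inner_sub_right, inner_sub_right]
    linarith
  exact sub_eq_zero.1 (real_inner_self_nonpos.1 this)

end general

end RootSystemBase
namespace GradedLieData

variable {V : Type*} [NormedAddCommGroup V] [InnerProductSpace ℝ V]
variable {L : Type*} [LieRing L] [LieAlgebra ℂ L]

section general
variable (G : GradedLieData V L)

theorem br_mem {β γ : V} (hβ : β ∈ G.base.Δ) (hγ : γ ∈ G.base.Δ) (h0 : β + γ ≠ 0)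
    {x y : L} (hx : x ∈ G.rs β) (hy : y ∈ G.rs γ) : ⁅x, y⁆ ∈ G.rs (β + γ) := by
  by_cases h : β + γ ∈ G.base.Δ
  · exact G.br_rs_mem β hβ γ hγ h x hx y hy
  · rw [G.br_rs_zero β hβ γ hγ h h0 x hx y hy]; exact Submodule.zero_mem _

theorem rs_le_erase {β γ : V} (h : γ ≠ β) :
    G.rs γ ≤ G.H ⊔ ⨆ δ ∈ G.base.Δ.erase β, G.rs δ := by
  by_cases hγ : γ ∈ G.base.Δ
  · exact le_sup_of_le_right (le_iSup₂_of_le γ (Finset.mem_erase.2 ⟨h, hγ⟩) le_rfl)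
  · rw [G.rs_bot γ hγ]; exact bot_le

theorem finrank_sup [FiniteDimensional ℂ L] (F : Finset V) (hF : F ⊆ G.base.Δ) :
    Module.finrank ℂ ↥(⨆ β ∈ F, G.rs β) = F.card := by
  induction F using Finset.induction_on with
  | empty => simp
  | insert β F hβ ih =>
    have hβΔ : β ∈ G.base.Δ := hF (Finset.mem_insert_self _ _)
    have hFΔ : F ⊆ G.base.Δ := fun x hx => hF (Finset.mem_insert_of_mem hx)
    rw [Finset.iSup_insert, Finset.card_insert_of_notMem hβ]
    have hdis : Disjoint (G.rs β) (⨆ γ ∈ F, G.rs γ) := by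
      refine (G.rs_indep β hβΔ).mono_right ?_
      refine iSup₂_le fun γ hγ => G.rs_le_erase ?_
      rintro rfl; exact hβ hγ
    have h1 := Submodule.finrank_sup_add_finrank_inf_eq (G.rs β) (⨆ γ ∈ F, G.rs γ)
    rw [disjoint_iff.1 hdis, finrank_bot, ih hFΔ, G.rs_dim β hβΔ] at h1
    omega

/-- roots of given height -/
noncomputable def rts (Sg : Finset V) (j : ℤ) : Finset V :=
  G.base.Δ.filter (fun β => G.base.ht Sg β = j)

theorem mem_rts {Sg : Finset V} {j : ℤ} {β : V} :
    β ∈ G.rts Sg j ↔ β ∈ G.base.Δ ∧ G.base.ht Sg β = j := by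
  simp [rts]

theorem g_eq (Sg : Finset V) {j : ℤ} (hj : j ≠ 0) : G.g Sg j = ⨆ β ∈ G.rts Sg j, G.rs β := by
  unfold g rts
  rw [if_neg hj]

theorem finrank_g [FiniteDimensional ℂ L] (Sg : Finset V) {j : ℤ} (hj : j ≠ 0) :
    Module.finrank ℂ ↥(G.g Sg j) = (G.rts Sg j).card := by
  rw [G.g_eq Sg hj]
  exact G.finrank_sup _ (Finset.filter_subset _ _)

theorem exists_gen {β : V} (hβ : β ∈ G.base.Δ) : ∃ e ∈ G.rs β, e ≠ 0 := by
  have h := G.rs_dim β hβ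
  have hb : G.rs β ≠ ⊥ := by
    intro hb
    rw [hb, finrank_bot] at h
    exact absurd h (by norm_num)
  exact (Submodule.ne_bot_iff _).1 hb

theorem add_ne_zero_of_ht {Sg : Finset V} (hS : Sg ⊆ G.base.Δ0) {β γ : V}
    (hβ : β ∈ G.rts Sg (-1)) (hγ : γ ∈ G.rts Sg (-1)) : β + γ ≠ 0 := by
  rw [mem_rts] at hβ hγ
  intro h
  have : γ = -β := by rw [eq_neg_iff_add_eq_zero, add_comm]; exact h
  have h2 := hγ.2
  rw [this, G.base.ht_neg hS hβ.1, hβ.2] at h2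
  norm_num at h2

theorem star_of_monge [FiniteDimensional ℂ L] {Sg : Finset V} (hS : Sg ⊆ G.base.Δ0)
    (hM : G.Monge Sg) :
    ∃ β ∈ G.base.Δ, G.base.ht Sg β = 1 ∧ (∀ γ ∈ G.base.Δ, ∀ δ ∈ G.base.Δ,
      G.base.ht Sg γ = 1 → G.base.ht Sg δ = 1 → γ ≠ β → δ ≠ β → γ ≠ δ → γ + δ ∉ G.base.Δ) := by
  obtain ⟨Y, hY, hY0, hab, hdim, -⟩ := hM
  have hex : ∃ β ∈ G.rts Sg (-1), ¬ G.rs β ≤ Y := by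
    by_contra hcon
    push Not at hcon
    have : G.g Sg (-1) ≤ Y := by
      rw [G.g_eq Sg (by norm_num)]
      exact iSup₂_le hcon
    have := Submodule.finrank_mono this
    omega
  obtain ⟨β, hβ, hβY⟩ := hex
  obtain ⟨e, he, heY⟩ := Set.not_subset.1 hβY
  have he : e ∈ G.rs β := he
  have heY : e ∉ Y := heY
  have hle : ∀ γ ∈ G.rts Sg (-1), G.rs γ ≤ G.g Sg (-1) := by
    intro γ hγ
    rw [G.g_eq Sg (by norm_num)]
    exact le_iSup₂_of_le γ hγ le_rfl
  have hsup : Y ⊔ Submodule.span ℂ {e} = G.g Sg (-1) := by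
    apply Submodule.eq_of_le_of_finrank_le
    · refine sup_le hY ?_
      rw [Submodule.span_singleton_le_iff_mem]
      exact hle β hβ he
    · rw [← hdim]
      have hlt : Y < Y ⊔ Submodule.span ℂ {e} := by
        refine lt_of_le_of_ne le_sup_left ?_
        intro h
        apply heY
        rw [h]
        exact Submodule.mem_sup_right (Submodule.mem_span_singleton_self e)
      exact Submodule.finrank_lt_finrank_of_lt hlt
  have hdec : ∀ γ ∈ G.rts Sg (-1), ∀ x ∈ G.rs γ, ∃ c : ℂ, x - c • e ∈ Y := by
    intro γ hγ x hx
    have hx' := hle γ hγ hx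
    rw [← hsup, Submodule.mem_sup] at hx'
    obtain ⟨y, hy, z, hz, hyz⟩ := hx'
    obtain ⟨c, rfl⟩ := Submodule.mem_span_singleton.1 hz
    exact ⟨c, by rw [← hyz]; simpa using hy⟩
  have key : ∀ γ ∈ G.rts Sg (-1), ∀ δ ∈ G.rts Sg (-1), γ ≠ β → δ ≠ β → γ ≠ δ →
      γ + δ ∉ G.base.Δ := by
    intro γ hγ δ hδ h1 h2 h3 hsum
    obtain ⟨x, hx, hx0⟩ := G.exists_gen (G.mem_rts.1 hγ).1
    obtain ⟨y, hy, hy0⟩ := G.exists_gen (G.mem_rts.1 hδ).1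
    obtain ⟨c, hc⟩ := hdec γ hγ x hx
    obtain ⟨d, hd⟩ := hdec δ hδ y hy
    have hz := hab _ hc _ hd
    have hexp : ⁅x, y⁆ = d • ⁅x, e⁆ + c • ⁅e, y⁆ := by
      simp only [lie_sub, sub_lie, lie_smul, smul_lie, lie_self, smul_zero, sub_zero] at hz
      rw [← sub_eq_zero, ← hz]
      abel
    have hβΔ := (G.mem_rts.1 hβ).1
    have hγΔ := (G.mem_rts.1 hγ).1
    have hδΔ := (G.mem_rts.1 hδ).1
    have m1 : ⁅x, y⁆ ∈ G.rs (γ + δ) := G.br_rs_mem γ hγΔ δ hδΔ hsum x hx y hy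
    have m2 : ⁅x, y⁆ ∈ G.H ⊔ ⨆ ε ∈ G.base.Δ.erase (γ + δ), G.rs ε := by
      rw [hexp]
      refine Submodule.add_mem _ (Submodule.smul_mem _ _ ?_) (Submodule.smul_mem _ _ ?_)
      · refine G.rs_le_erase ?_ (G.br_mem hγΔ hβΔ (G.add_ne_zero_of_ht hS hγ hβ) hx he)
        intro h; exact h2 (add_left_cancel h).symm
      · refine G.rs_le_erase ?_ (G.br_mem hβΔ hδΔ (G.add_ne_zero_of_ht hS hβ hδ) he hy)
        intro h; exact h1 (add_right_cancel h).symm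
    have := Submodule.disjoint_def.1 (G.rs_indep _ hsum) _ m1 m2
    rcases G.br_nondeg γ hγΔ δ hδΔ hsum x hx y hy this with h | h
    · exact hx0 h
    · exact hy0 h
  have hβ' := G.mem_rts.1 hβ
  refine ⟨-β, G.base.neg_mem _ hβ'.1, by rw [G.base.ht_neg hS hβ'.1, hβ'.2]; norm_num, ?_⟩
  intro γ hγ δ hδ h1 h2 n1 n2 n3 hsum
  refine key (-γ) ?_ (-δ) ?_ ?_ ?_ ?_ ?_
  · rw [mem_rts, G.base.ht_neg hS hγ, h1]; exact ⟨G.base.neg_mem _ hγ, rfl⟩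
  · rw [mem_rts, G.base.ht_neg hS hδ, h2]; exact ⟨G.base.neg_mem _ hδ, rfl⟩
  · intro h; exact n1 (by rw [← h, neg_neg])
  · intro h; exact n2 (by rw [← h, neg_neg])
  · intro h; exact n3 (neg_injective h)
  · rw [← neg_add]; exact G.base.neg_mem _ hsum

theorem ht_two_of_monge [FiniteDimensional ℂ L] {Sg : Finset V} (hS : Sg ⊆ G.base.Δ0)
    (hM : G.Monge Sg) : ∃ β ∈ G.base.Δ, G.base.ht Sg β = 2 := by
  obtain ⟨Y, hY, hY0, hab, hdim, h2⟩ := hM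
  have : 0 < Module.finrank ℂ Y := by
    rw [Module.finrank_pos_iff]
    exact (Submodule.nontrivial_iff_ne_bot).2 hY0
  rw [← h2, G.finrank_g Sg (by norm_num), Finset.card_pos] at this
  obtain ⟨β, hβ⟩ := this
  rw [mem_rts] at hβ
  exact ⟨-β, G.base.neg_mem _ hβ.1, by rw [G.base.ht_neg hS hβ.1, hβ.2]; norm_num⟩

theorem monge_of_star [FiniteDimensional ℂ L] {Sg : Finset V} (hS : Sg ⊆ G.base.Δ0) (β : V)
    (hβ : β ∈ G.base.Δ) (hβ1 : G.base.ht Sg β = 1)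
    (hex : ∃ γ ∈ G.base.Δ, G.base.ht Sg γ = 1 ∧ γ ≠ β)
    (h1 : ∀ γ ∈ G.base.Δ, G.base.ht Sg γ = 1 → γ ≠ β → γ + β ∈ G.base.Δ)
    (h2 : ∀ δ ∈ G.base.Δ, G.base.ht Sg δ = 2 → δ - β ∈ G.base.Δ)
    (h3 : ∀ γ ∈ G.base.Δ, ∀ δ ∈ G.base.Δ, G.base.ht Sg γ = 1 → G.base.ht Sg δ = 1 →
      γ ≠ β → δ ≠ β → γ ≠ δ → γ + δ ∉ G.base.Δ) : G.Monge Sg := by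
  have hneg : ∀ γ ∈ G.base.Δ, ∀ j, G.base.ht Sg γ = j → G.base.ht Sg (-γ) = -j := by
    intro γ hγ j hj; rw [G.base.ht_neg hS hγ, hj]
  set N := (G.rts Sg (-1)).erase (-β) with hN
  have hNsub : N ⊆ G.base.Δ := fun x hx => (G.mem_rts.1 (Finset.mem_of_mem_erase hx)).1
  have hmN : ∀ γ ∈ N, -γ ∈ G.base.Δ ∧ G.base.ht Sg (-γ) = 1 ∧ -γ ≠ β := by
    intro γ hγ
    rw [hN, Finset.mem_erase, mem_rts] at hγ
    refine ⟨G.base.neg_mem _ hγ.2.1, by simpa using hneg γ hγ.2.1 _ hγ.2.2, ?_⟩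
    intro h; apply hγ.1; rw [← h, neg_neg]
  have hmem : -β ∈ G.rts Sg (-1) := by
    rw [mem_rts]; exact ⟨G.base.neg_mem _ hβ, hneg β hβ 1 hβ1⟩
  have hcard : N.card + 1 = (G.rts Sg (-1)).card := Finset.card_erase_add_one hmem
  have hnn : N.Nonempty := by
    obtain ⟨γ, hγ, hγ1, hγβ⟩ := hex
    refine ⟨-γ, ?_⟩
    rw [hN, Finset.mem_erase, mem_rts]
    exact ⟨fun h => hγβ (neg_injective h), G.base.neg_mem _ hγ, hneg γ hγ 1 hγ1⟩
  have hc2 : (G.rts Sg (-2)).card = N.card := by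
    symm
    apply Finset.card_bij (fun γ _ => γ + -β)
    · intro γ hγ
      obtain ⟨a1, a2, a3⟩ := hmN γ hγ
      have := h1 _ a1 a2 a3
      have e : γ + -β = -(-γ + β) := by abel
      rw [e, mem_rts]
      refine ⟨G.base.neg_mem _ this, ?_⟩
      rw [G.base.ht_neg hS this, G.base.ht_add hS a1 hβ this, a2, hβ1]; norm_num
    · intro γ _ δ _ h; exact add_right_cancel h
    · intro δ hδ
      rw [mem_rts] at hδ
      have d1 := G.base.neg_mem _ hδ.1
      have d2 : G.base.ht Sg (-δ) = 2 := by simpa using hneg δ hδ.1 _ hδ.2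
      have d3 := h2 _ d1 d2
      have d4 : G.base.ht Sg (-δ - β) = 1 := by
        have hh := G.base.ht_add hS d3 hβ (by simpa using d1)
        rw [sub_add_cancel, d2, hβ1] at hh
        omega
      refine ⟨δ + β, ?_, by abel⟩
      have e : δ + β = -(-δ - β) := by abel
      rw [hN, Finset.mem_erase, mem_rts, e]
      refine ⟨?_, G.base.neg_mem _ d3, hneg _ d3 1 d4⟩
      intro h
      have h' := neg_injective h
      apply G.base.reduced β hβ
      have : (2 : ℝ) • β = -δ := by rw [two_smul]; nth_rewrite 1 [← h']; abel
      rw [this]; exact d1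
  refine ⟨⨆ γ ∈ N, G.rs γ, ?_, ?_, ?_, ?_, ?_⟩
  · rw [G.g_eq Sg (by norm_num)]
    exact biSup_mono fun γ hγ => Finset.mem_of_mem_erase hγ
  · intro h
    have := G.finrank_sup N hNsub
    rw [h, finrank_bot] at this
    have := Finset.card_pos.2 hnn
    omega
  · have hbr : ∀ γ ∈ N, ∀ δ ∈ N, ∀ x ∈ G.rs γ, ∀ y ∈ G.rs δ, ⁅x, y⁆ = 0 := by
      intro γ hγ δ hδ x hx y hy
      obtain ⟨a1, a2, a3⟩ := hmN γ hγ
      obtain ⟨b1, b2, b3⟩ := hmN δ hδ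
      refine G.br_rs_zero γ (hNsub hγ) δ (hNsub hδ) ?_ ?_ x hx y hy
      · intro hs
        by_cases hgd : γ = δ
        · subst hgd
          apply G.base.reduced γ (hNsub hγ)
          rw [two_smul]; exact hs
        · refine h3 _ a1 _ b1 a2 b2 a3 b3 (fun h => hgd (neg_injective h)) ?_
          rw [← neg_add]; exact G.base.neg_mem _ hs
      · exact G.add_ne_zero_of_ht hS (Finset.mem_of_mem_erase hγ) (Finset.mem_of_mem_erase hδ)
    have hb1 : ∀ γ ∈ N, ∀ x ∈ G.rs γ, ∀ b ∈ (⨆ γ ∈ N, G.rs γ), ⁅x, b⁆ = 0 := by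
      intro γ hγ x hx
      have : (⨆ γ ∈ N, G.rs γ) ≤ LinearMap.ker (LieAlgebra.ad ℂ L x) := by
        refine iSup₂_le fun δ hδ y hy => ?_
        rw [LinearMap.mem_ker, LieAlgebra.ad_apply]
        exact hbr γ hγ δ hδ x hx y hy
      intro b hb
      exact LinearMap.mem_ker.1 (this hb)
    intro a ha b hb
    have : (⨆ γ ∈ N, G.rs γ) ≤ LinearMap.ker (LieAlgebra.ad ℂ L b) := by
      refine iSup₂_le fun δ hδ y hy => ?_
      rw [LinearMap.mem_ker, LieAlgebra.ad_apply, ← lie_skew, hb1 δ hδ y hy b hb, neg_zero]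
    have h := LinearMap.mem_ker.1 (this ha)
    rw [LieAlgebra.ad_apply] at h
    rw [← lie_skew, h, neg_zero]
  · rw [G.finrank_sup N hNsub, G.finrank_g Sg (by norm_num), hcard]
  · rw [G.finrank_sup N hNsub, G.finrank_g Sg (by norm_num), hc2]

end general

end GradedLieData
namespace RootSystemBase

variable {V : Type*} [NormedAddCommGroup V] [InnerProductSpace ℝ V]

/-- The integral combination of `α 1, …, α ℓ` with coefficients `c`. -/
noncomputable def vec (α : ℕ → V) (ℓ : ℕ) (c : ℕ → ℤ) : V :=
  ∑ i ∈ Finset.Icc 1 ℓ, (c i : ℝ) • α i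

/-- Pairing of a coefficient vector with the `j`-th simple root. -/
def pr (A : ℕ → ℕ → ℤ) (ℓ : ℕ) (c : ℕ → ℤ) (j : ℕ) : ℤ := ∑ i ∈ Finset.Icc 1 ℓ, c i * A i j

/-- Integral version of `IsTypeOf`. -/
def Ty (R : RootSystemBase V) (ℓ : ℕ) (α : ℕ → V) (A : ℕ → ℕ → ℤ) : Prop :=
  R.IsTypeOf ℓ α (fun i j => (A i j : ℝ))

section vecs
variable {R : RootSystemBase V} {ℓ : ℕ} {α : ℕ → V} {A : ℕ → ℕ → ℤ}

theorem vec_congr {c d : ℕ → ℤ} (h : ∀ i ∈ Finset.Icc 1 ℓ, c i = d i) :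
    vec α ℓ c = vec α ℓ d := by
  unfold vec
  exact Finset.sum_congr rfl fun i hi => by rw [h i hi]

theorem vec_add (c d : ℕ → ℤ) : vec α ℓ (c + d) = vec α ℓ c + vec α ℓ d := by
  unfold vec
  rw [← Finset.sum_add_distrib]
  exact Finset.sum_congr rfl fun i hi => by simp [add_smul]

theorem vec_sub (c d : ℕ → ℤ) : vec α ℓ (c - d) = vec α ℓ c - vec α ℓ d := by
  unfold vec
  rw [← Finset.sum_sub_distrib]
  exact Finset.sum_congr rfl fun i hi => by simp [sub_smul]

theorem vec_single {j : ℕ} (hj : j ∈ Finset.Icc 1 ℓ) (k : ℤ) :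
    vec α ℓ (Pi.single j k) = (k : ℝ) • α j := by
  unfold vec
  rw [Finset.sum_eq_single j]
  · simp
  · intro b _ hb; simp [hb]
  · intro h; exact absurd hj h

theorem vec_single_one {j : ℕ} (hj : j ∈ Finset.Icc 1 ℓ) :
    vec α ℓ (Pi.single j 1) = α j := by
  rw [vec_single hj]; simp

theorem Ty.simple_mem (hT : R.Ty ℓ α A) {j : ℕ} (hj : j ∈ Finset.Icc 1 ℓ) : α j ∈ R.Δ0 := by
  rw [hT.2.1]; exact Finset.mem_image_of_mem _ hj

theorem Ty.mem (hT : R.Ty ℓ α A) {j : ℕ} (hj : j ∈ Finset.Icc 1 ℓ) : α j ∈ R.Δ :=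
  R.base_sub (hT.simple_mem hj)

theorem Ty.inj (hT : R.Ty ℓ α A) {i j : ℕ} (hi : i ∈ Finset.Icc 1 ℓ)
    (hj : j ∈ Finset.Icc 1 ℓ) (h : α i = α j) : i = j :=
  hT.1 (by simpa using hi) (by simpa using hj) h

theorem Ty.exists_idx (hT : R.Ty ℓ α A) {a : V} (ha : a ∈ R.Δ0) :
    ∃ j ∈ Finset.Icc 1 ℓ, α j = a := by
  rw [hT.2.1] at ha; simpa only [Finset.mem_image] using ha

theorem Ty.cInt_eq (hT : R.Ty ℓ α A) {i j : ℕ} (hi : i ∈ Finset.Icc 1 ℓ)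
    (hj : j ∈ Finset.Icc 1 ℓ) : cInt (α i) (α j) = A i j := hT.2.2 i hi j hj

theorem Ty.vec_inj (hT : R.Ty ℓ α A) {c d : ℕ → ℤ} (h : vec α ℓ c = vec α ℓ d) :
    ∀ i ∈ Finset.Icc 1 ℓ, c i = d i := by
  have hli : LinearIndependent ℝ (fun i : ↥(Finset.Icc 1 ℓ) => α i) := by
    have := R.indep.comp (fun i : ↥(Finset.Icc 1 ℓ) => (⟨α i, hT.simple_mem i.2⟩ : ↥R.Δ0))
      (by
        intro i j hij
        have : α i = α j := congrArg Subtype.val hij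
        exact Subtype.ext (hT.inj i.2 j.2 this))
    exact this
  have h2 : ∑ i ∈ Finset.Icc 1 ℓ, ((c i : ℝ) - d i) • α i = 0 := by
    simp only [sub_smul, Finset.sum_sub_distrib]
    exact sub_eq_zero.2 h
  have h4 := linearIndependent_iff'.1 hli Finset.univ (fun i => (c i : ℝ) - d i)
    (by rw [← h2]; exact Finset.sum_coe_sort (Finset.Icc 1 ℓ) (fun i => ((c i : ℝ) - d i) • α i))
  intro i hi
  have := sub_eq_zero.1 (h4 ⟨i, hi⟩ (Finset.mem_univ _))
  exact_mod_cast this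

theorem Ty.spec (hT : R.Ty ℓ α A) {β : V} (hβ : β ∈ R.Δ) :
    β = vec α ℓ (fun i => R.coeff β (α i)) := by
  conv_lhs => rw [R.coeff_spec β hβ]
  unfold vec
  rw [hT.2.1, Finset.sum_image]
  intro i hi j hj h
  exact hT.inj hi hj h

theorem Ty.exists_vec (hT : R.Ty ℓ α A) {β : V} (hβ : β ∈ R.Δ) :
    ∃ c, β = vec α ℓ c := ⟨_, hT.spec hβ⟩

theorem Ty.coeff_vec (hT : R.Ty ℓ α A) {c : ℕ → ℤ} (h : vec α ℓ c ∈ R.Δ) {i : ℕ}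
    (hi : i ∈ Finset.Icc 1 ℓ) : R.coeff (vec α ℓ c) (α i) = c i :=
  (hT.vec_inj (hT.spec h) i hi).symm

theorem Ty.cInt_vec (hT : R.Ty ℓ α A) (c : ℕ → ℤ) {j : ℕ} (hj : j ∈ Finset.Icc 1 ℓ) :
    cInt (vec α ℓ c) (α j) = (pr A ℓ c j : ℝ) := by
  unfold cInt vec pr
  rw [sum_inner, Finset.mul_sum, Finset.sum_div]
  push_cast
  refine Finset.sum_congr rfl fun i hi => ?_
  rw [← hT.cInt_eq hi hj, inner_smul_left]
  unfold cInt
  simp only [conj_trivial]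
  ring

theorem Ty.refl_vec (hT : R.Ty ℓ α A) (c : ℕ → ℤ) {j : ℕ} (hj : j ∈ Finset.Icc 1 ℓ) :
    refl (α j) (vec α ℓ c) = vec α ℓ (c - Pi.single j (pr A ℓ c j)) := by
  rw [vec_sub, vec_single hj, refl, hT.cInt_vec c hj]

theorem Ty.refl_mem (hT : R.Ty ℓ α A) {c : ℕ → ℤ} (hc : vec α ℓ c ∈ R.Δ) {j : ℕ}
    (hj : j ∈ Finset.Icc 1 ℓ) : vec α ℓ (c - Pi.single j (pr A ℓ c j)) ∈ R.Δ := by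
  rw [← hT.refl_vec c hj]; exact R.refl_mem (hT.mem hj) hc

theorem Ty.refl_mem' (hT : R.Ty ℓ α A) {c d : ℕ → ℤ} (hc : vec α ℓ c ∈ R.Δ) {j : ℕ}
    (hj : j ∈ Finset.Icc 1 ℓ) {k : ℤ} (hk : pr A ℓ c j = k)
    (hd : ∀ i ∈ Finset.Icc 1 ℓ, d i = if i = j then c i - k else c i) :
    vec α ℓ d ∈ R.Δ := by
  have := hT.refl_mem hc hj
  rw [hk] at this
  rw [vec_congr (d := c - Pi.single j k)]
  · exact this
  · intro i hi
    rw [hd i hi]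
    by_cases h : i = j
    · subst h; simp
    · simp [h]

theorem Ty.sign (hT : R.Ty ℓ α A) {c : ℕ → ℤ} (hc : vec α ℓ c ∈ R.Δ) :
    (∀ i ∈ Finset.Icc 1 ℓ, 0 ≤ c i) ∨ (∀ i ∈ Finset.Icc 1 ℓ, c i ≤ 0) := by
  rcases R.coeff_sign _ hc with h | h
  · left; intro i hi; rw [← hT.coeff_vec hc hi]; exact h _ (hT.simple_mem hi)
  · right; intro i hi; rw [← hT.coeff_vec hc hi]; exact h _ (hT.simple_mem hi)

/-- If all coefficients but the `j`-th of a root vanish and the `j`-th is nonnegative,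
it is equal to one. -/
theorem Ty.eq_one (hT : R.Ty ℓ α A) {c : ℕ → ℤ} (hc : vec α ℓ c ∈ R.Δ) {j : ℕ}
    (hj : j ∈ Finset.Icc 1 ℓ) (h0 : 0 ≤ c j)
    (h : ∀ i ∈ Finset.Icc 1 ℓ, i ≠ j → c i = 0) : vec α ℓ c = α j := by
  apply R.eq_of_coeff_zero (hT.simple_mem hj) hc
  · rw [hT.coeff_vec hc hj]; exact h0
  · intro b hb hba
    obtain ⟨i, hi, rfl⟩ := hT.exists_idx hb
    rw [hT.coeff_vec hc hi]
    exact h i hi (by rintro rfl; exact hba rfl)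

theorem Ty.ht_vec (hT : R.Ty ℓ α A) {I : Finset ℕ} (hI : I ⊆ Finset.Icc 1 ℓ) {c : ℕ → ℤ}
    (hc : vec α ℓ c ∈ R.Δ) : R.ht (I.image α) (vec α ℓ c) = ∑ i ∈ I, c i := by
  unfold ht
  rw [Finset.sum_image]
  · exact Finset.sum_congr rfl fun i hi => hT.coeff_vec hc (hI hi)
  · intro i hi j hj h
    exact hT.inj (hI hi) (hI hj) h

theorem Ty.image_sub (hT : R.Ty ℓ α A) {I : Finset ℕ} (hI : I ⊆ Finset.Icc 1 ℓ) :
    I.image α ⊆ R.Δ0 := by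
  rw [hT.2.1]; exact Finset.image_subset_image hI

theorem Ty.pr_single (A : ℕ → ℕ → ℤ) {j : ℕ} (hj : j ∈ Finset.Icc 1 ℓ) (i : ℕ) :
    pr A ℓ (Pi.single j 1) i = A j i := by
  unfold pr
  rw [Finset.sum_eq_single j]
  · simp
  · intro b _ hb; simp [hb]
  · intro h; exact absurd hj h

theorem Ty.nonRigid_iff (hT : R.Ty ℓ α A) {I : Finset ℕ} (hI : I ⊆ Finset.Icc 1 ℓ) {w : ℕ → ℤ}
    (hw : vec α ℓ w ∈ R.Δ) :
    R.NonRigid (I.image α) (vec α ℓ w) ↔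
    ∃ i ∈ I, ∃ j ∈ Finset.Icc 1 ℓ, i ≠ j ∧
      0 < (if j ∈ I then 1 else 0) - A j i ∧
      ∑ k ∈ I, w k ≤ pr A ℓ w i + (pr A ℓ w j + 1) * ((if j ∈ I then 1 else 0) - A j i) := by
  have hsimp : ∀ i ∈ Finset.Icc 1 ℓ, R.ht (I.image α) (α i) = if i ∈ I then 1 else 0 := by
    intro i hi
    have := hT.ht_vec hI (c := Pi.single i 1) (by rw [vec_single_one hi]; exact hT.mem hi)
    rw [vec_single_one hi] at this
    rw [this]
    simp [Pi.single_apply]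
  have hrefl : ∀ i ∈ I, ∀ j ∈ Finset.Icc 1 ℓ, R.ht (I.image α) (refl (α i) (α j)) =
      (if j ∈ I then 1 else 0) - A j i := by
    intro i hi j hj
    have hmem : vec α ℓ (Pi.single j 1) ∈ R.Δ := by rw [vec_single_one hj]; exact hT.mem hj
    have h1 := hT.refl_vec (Pi.single j 1) (hI hi)
    have h2 := hT.refl_mem hmem (hI hi)
    rw [vec_single_one hj] at h1
    rw [h1, hT.ht_vec hI h2, Ty.pr_single A hj]
    simp [Pi.single_apply, hi]
  rw [RootSystemBase.nonRigid_iff]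
  constructor
  · rintro ⟨a, ha, b, hb, hne, h1, h2, h3⟩
    obtain ⟨i, hi, rfl⟩ := hT.exists_idx ha
    obtain ⟨j, hj, rfl⟩ := hT.exists_idx hb
    have hiI : i ∈ I := by
      rw [hsimp i hi] at h1
      by_contra h
      simp [h] at h1
    refine ⟨i, hiI, j, hj, by rintro rfl; exact hne rfl, ?_, ?_⟩
    · rw [hrefl i hiI j hj] at h2; exact h2
    · rw [hrefl i hiI j hj, hT.ht_vec hI hw, hT.cInt_vec w hi, hT.cInt_vec w hj] at h3
      exact_mod_cast h3
  · rintro ⟨i, hi, j, hj, hne, h2, h3⟩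
    refine ⟨α i, hT.simple_mem (hI hi), α j, hT.simple_mem hj,
      fun h => hne (hT.inj (hI hi) hj h), ?_, ?_, ?_⟩
    · rw [hsimp i (hI hi), if_pos hi]; norm_num
    · rw [hrefl i hi j hj]; exact h2
    · rw [hrefl i hi j hj, hT.ht_vec hI hw, hT.cInt_vec w (hI hi), hT.cInt_vec w hj]
      exact_mod_cast h3

/-- identification of the highest root -/
theorem Ty.highest_eq (hT : R.Ty ℓ α A) {θ : V} (hθ : R.IsHighest θ) {w : ℕ → ℤ}
    (hw : vec α ℓ w ∈ R.Δ) (hdom : ∀ j ∈ Finset.Icc 1 ℓ, 0 ≤ pr A ℓ w j)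
    (hn : ∀ j ∈ Finset.Icc 1 ℓ, ⟪α j, α j⟫ ≤ ⟪vec α ℓ w, vec α ℓ w⟫) : θ = vec α ℓ w := by
  apply R.highest_eq hθ hw
  · intro a ha
    obtain ⟨j, hj, rfl⟩ := hT.exists_idx ha
    rw [R.inner_eq_cInt (hT.mem hj), hT.cInt_vec w hj]
    have := R.inner_self_pos (hT.mem hj)
    have h : (0 : ℝ) ≤ pr A ℓ w j := by exact_mod_cast hdom j hj
    positivity
  · intro a ha
    obtain ⟨j, hj, rfl⟩ := hT.exists_idx ha
    exact hn j hj

theorem Ty.norm_vec (hT : R.Ty ℓ α A) (w : ℕ → ℤ) : ⟪vec α ℓ w, vec α ℓ w⟫ =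
    ∑ j ∈ Finset.Icc 1 ℓ, (w j * pr A ℓ w j : ℝ) * ⟪α j, α j⟫ / 2 := by
  conv_lhs => rw [show ⟪vec α ℓ w, vec α ℓ w⟫ = ⟪vec α ℓ w, ∑ i ∈ Finset.Icc 1 ℓ, (w i : ℝ) • α i⟫
    from rfl]
  rw [inner_sum]
  refine Finset.sum_congr rfl fun j hj => ?_
  rw [inner_smul_right, R.inner_eq_cInt (hT.mem hj), hT.cInt_vec w hj]
  ring

theorem Ty.norm_rel (hT : R.Ty ℓ α A) {i j : ℕ} (hi : i ∈ Finset.Icc 1 ℓ)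
    (hj : j ∈ Finset.Icc 1 ℓ) : (A i j : ℝ) * ⟪α j, α j⟫ = A j i * ⟪α i, α i⟫ := by
  rw [← hT.cInt_eq hi hj, ← hT.cInt_eq hj hi]
  have h1 := R.inner_eq_cInt (hT.mem hj) (α i)
  have h2 := R.inner_eq_cInt (hT.mem hi) (α j)
  have := real_inner_comm (α i) (α j)
  linarith

theorem highest_bound (hT : R.Ty ℓ α A) {w c : ℕ → ℤ} (hθ : R.IsHighest (vec α ℓ w))
    (hc : vec α ℓ c ∈ R.Δ) {i : ℕ} (hi : i ∈ Finset.Icc 1 ℓ) : c i ≤ w i := by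
  have := hθ.2 _ hc (α i) (hT.simple_mem hi)
  rwa [hT.coeff_vec hc hi, hT.coeff_vec hθ.1 hi] at this

end vecs

end RootSystemBase

namespace GradedLieData
open RootSystemBase
variable {V : Type*} [NormedAddCommGroup V] [InnerProductSpace ℝ V]
variable {L : Type*} [LieRing L] [LieAlgebra ℂ L] [FiniteDimensional ℂ L]
variable {G : GradedLieData V L} {ℓ : ℕ} {α : ℕ → V} {A : ℕ → ℕ → ℤ}

/-- Two disjoint edges prevent a grading from being of Monge type. -/
theorem not_monge_edges (hT : G.base.Ty ℓ α A) {I : Finset ℕ} (hI : I ⊆ Finset.Icc 1 ℓ)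
    (a b c d : ℕ → ℤ) (ha : vec α ℓ a ∈ G.base.Δ) (hb : vec α ℓ b ∈ G.base.Δ)
    (hc : vec α ℓ c ∈ G.base.Δ) (hd : vec α ℓ d ∈ G.base.Δ)
    (hab : vec α ℓ (a + b) ∈ G.base.Δ) (hcd : vec α ℓ (c + d) ∈ G.base.Δ)
    (h1 : ∑ i ∈ I, a i = 1) (h2 : ∑ i ∈ I, b i = 1)
    (h3 : ∑ i ∈ I, c i = 1) (h4 : ∑ i ∈ I, d i = 1)
    (n1 : ∃ i ∈ Finset.Icc 1 ℓ, a i ≠ c i) (n2 : ∃ i ∈ Finset.Icc 1 ℓ, a i ≠ d i)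
    (n3 : ∃ i ∈ Finset.Icc 1 ℓ, b i ≠ c i) (n4 : ∃ i ∈ Finset.Icc 1 ℓ, b i ≠ d i)
    (n5 : ∃ i ∈ Finset.Icc 1 ℓ, a i ≠ b i) (n6 : ∃ i ∈ Finset.Icc 1 ℓ, c i ≠ d i) :
    ¬ G.Monge (I.image α) := by
  intro hM
  obtain ⟨β, hβ, -, hst⟩ := G.star_of_monge (hT.image_sub hI) hM
  have hne : ∀ {x y : ℕ → ℤ}, (∃ i ∈ Finset.Icc 1 ℓ, x i ≠ y i) → vec α ℓ x ≠ vec α ℓ y := by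
    rintro x y ⟨i, hi, h⟩ h'
    exact h (hT.vec_inj h' i hi)
  have e1 := hst _ ha _ hb (by rw [hT.ht_vec hI ha, h1]) (by rw [hT.ht_vec hI hb, h2])
  have e2 := hst _ hc _ hd (by rw [hT.ht_vec hI hc, h3]) (by rw [hT.ht_vec hI hd, h4])
  rw [← vec_add] at e1 e2
  have k1 : vec α ℓ a = β ∨ vec α ℓ b = β := by
    by_contra h
    push Not at h
    exact e1 h.1 h.2 (hne n5) hab
  have k2 : vec α ℓ c = β ∨ vec α ℓ d = β := by
    by_contra h
    push Not at h
    exact e2 h.1 h.2 (hne n6) hcd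
  rcases k1 with k1 | k1 <;> rcases k2 with k2 | k2
  · exact hne n1 (k1.trans k2.symm)
  · exact hne n2 (k1.trans k2.symm)
  · exact hne n3 (k1.trans k2.symm)
  · exact hne n4 (k1.trans k2.symm)

/-- A triangle prevents a grading from being of Monge type. -/
theorem not_monge_triangle (hT : G.base.Ty ℓ α A) {I : Finset ℕ} (hI : I ⊆ Finset.Icc 1 ℓ)
    (a b c : ℕ → ℤ) (ha : vec α ℓ a ∈ G.base.Δ) (hb : vec α ℓ b ∈ G.base.Δ)
    (hc : vec α ℓ c ∈ G.base.Δ)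
    (hab : vec α ℓ (a + b) ∈ G.base.Δ) (hac : vec α ℓ (a + c) ∈ G.base.Δ)
    (hbc : vec α ℓ (b + c) ∈ G.base.Δ)
    (h1 : ∑ i ∈ I, a i = 1) (h2 : ∑ i ∈ I, b i = 1) (h3 : ∑ i ∈ I, c i = 1)
    (n1 : ∃ i ∈ Finset.Icc 1 ℓ, a i ≠ c i) (n2 : ∃ i ∈ Finset.Icc 1 ℓ, a i ≠ b i)
    (n3 : ∃ i ∈ Finset.Icc 1 ℓ, b i ≠ c i) :
    ¬ G.Monge (I.image α) := by
  intro hM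
  obtain ⟨β, hβ, -, hst⟩ := G.star_of_monge (hT.image_sub hI) hM
  have hne : ∀ {x y : ℕ → ℤ}, (∃ i ∈ Finset.Icc 1 ℓ, x i ≠ y i) → vec α ℓ x ≠ vec α ℓ y := by
    rintro x y ⟨i, hi, h⟩ h'
    exact h (hT.vec_inj h' i hi)
  have t1 : G.base.ht (I.image α) (vec α ℓ a) = 1 := by rw [hT.ht_vec hI ha, h1]
  have t2 : G.base.ht (I.image α) (vec α ℓ b) = 1 := by rw [hT.ht_vec hI hb, h2]
  have t3 : G.base.ht (I.image α) (vec α ℓ c) = 1 := by rw [hT.ht_vec hI hc, h3]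
  have e1 := hst _ ha _ hb t1 t2
  have e2 := hst _ ha _ hc t1 t3
  have e3 := hst _ hb _ hc t2 t3
  rw [← vec_add] at e1 e2 e3
  have m1 := hne n1
  have m2 := hne n2
  have m3 := hne n3
  by_cases ka : vec α ℓ a = β
  · exact e3 (fun h => m2 (ka.trans h.symm)) (fun h => m1 (ka.trans h.symm)) m3 hbc
  · by_cases kb : vec α ℓ b = β
    · exact e2 ka (fun h => m3 (kb.trans h.symm)) m1 hac
    · exact e1 ka kb m2 hab

theorem not_monge_single (hT : G.base.Ty ℓ α A) {w : ℕ → ℤ}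
    (hθ : G.base.IsHighest (vec α ℓ w)) {k : ℕ} (hk : k ∈ Finset.Icc 1 ℓ) (hw : w k = 1) :
    ¬ G.Monge (({k} : Finset ℕ).image α) := by
  have hI : ({k} : Finset ℕ) ⊆ Finset.Icc 1 ℓ := by simpa using hk
  intro hM
  obtain ⟨β, hβ, h2⟩ := G.ht_two_of_monge (hT.image_sub hI) hM
  obtain ⟨c, rfl⟩ := hT.exists_vec hβ
  rw [hT.ht_vec hI hβ, Finset.sum_singleton] at h2
  have := highest_bound hT hθ hβ hk
  omega

/-- `{α₁, α₂}` is of Monge type when the first row of the Cartan matrix is that of a chain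
and the highest root has `α₁`-coefficient one. -/
theorem monge_one_two (hT : G.base.Ty ℓ α A) (hl : 2 ≤ ℓ) {w : ℕ → ℤ}
    (hθ : G.base.IsHighest (vec α ℓ w)) (hw : w 1 = 1)
    (hpr : ∀ c, pr A ℓ c 1 = 2 * c 1 - c 2) :
    G.Monge (({1, 2} : Finset ℕ).image α) := by
  have m1 : 1 ∈ Finset.Icc 1 ℓ := by simp; omega
  have m2 : 2 ∈ Finset.Icc 1 ℓ := by simp; omega
  have hI : ({1, 2} : Finset ℕ) ⊆ Finset.Icc 1 ℓ := by
    intro i hi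
    simp at hi
    rcases hi with rfl | rfl <;> assumption
  have hsum : ∀ {c}, vec α ℓ c ∈ G.base.Δ →
      G.base.ht (({1, 2} : Finset ℕ).image α) (vec α ℓ c) = c 1 + c 2 := by
    intro c hc
    rw [hT.ht_vec hI hc]; simp
  have hle : ∀ {c}, vec α ℓ c ∈ G.base.Δ → c 1 ≤ 1 := by
    intro c hc
    have := highest_bound hT hθ hc m1
    omega
  have hle' : ∀ {c}, vec α ℓ c ∈ G.base.Δ → c 2 - c 1 ≤ 1 := by
    intro c hc
    have h := hle (hT.refl_mem hc m1)
    rw [hpr] at h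
    simp at h
    omega
  have hN : ∀ {c}, vec α ℓ c ∈ G.base.Δ → c 1 + c 2 = 1 → vec α ℓ c ≠ α 1 → c 1 = 0 ∧ c 2 = 1 := by
    intro c hc h1 hne
    have hs : ∀ i ∈ Finset.Icc 1 ℓ, 0 ≤ c i := by
      rcases hT.sign hc with h | h
      · exact h
      · have := h 1 m1
        have := h 2 m2
        omega
    have a1 := hs 1 m1
    have a2 := hs 2 m2
    by_contra hcon
    have c1 : c 1 = 1 := by omega
    have c2 : c 2 = 0 := by omega
    apply hne
    apply hT.eq_one hc m1 a1
    intro i hi hi1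
    have hr := hT.refl_mem hc m1
    rw [hpr] at hr
    have hi0 := hs i hi
    rcases hT.sign hr with h | h
    · have := h 1 m1
      simp at this
      omega
    · have := h i hi
      simp [hi1] at this
      omega
  have s1 : vec α ℓ (Pi.single 1 1) = α 1 := vec_single_one m1
  have s2 : vec α ℓ (Pi.single 2 1) = α 2 := vec_single_one m2
  refine G.monge_of_star (hT.image_sub hI) (α 1) (hT.mem m1) ?_ ⟨α 2, hT.mem m2, ?_, ?_⟩ ?_ ?_ ?_
  · rw [← s1, hsum (by rw [s1]; exact hT.mem m1)]; simp
  · rw [← s2, hsum (by rw [s2]; exact hT.mem m2)]; simp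
  · intro h; exact absurd (hT.inj m2 m1 h) (by norm_num)
  · intro γ hγ h1 hne
    obtain ⟨c, rfl⟩ := hT.exists_vec hγ
    rw [hsum hγ] at h1
    obtain ⟨c1, c2⟩ := hN hγ h1 hne
    have hr := hT.refl_mem hγ m1
    rw [hpr, c1, c2, vec_sub, vec_single m1] at hr
    simpa using hr
  · intro γ hγ h1
    obtain ⟨c, rfl⟩ := hT.exists_vec hγ
    rw [hsum hγ] at h1
    have b1 := hle hγ
    have b2 := hle' hγ
    have hr := hT.refl_mem hγ m1
    rw [hpr, show c 1 = 1 by omega, show c 2 = 1 by omega, vec_sub, vec_single m1] at hr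
    simpa using hr
  · intro γ hγ δ hδ h1 h2 n1 n2 _ hs
    obtain ⟨c, rfl⟩ := hT.exists_vec hγ
    obtain ⟨d, rfl⟩ := hT.exists_vec hδ
    rw [hsum hγ] at h1
    rw [hsum hδ] at h2
    obtain ⟨c1, c2⟩ := hN hγ h1 n1
    obtain ⟨d1, d2⟩ := hN hδ h2 n2
    rw [← vec_add] at hs
    have := hle' hs
    simp [c1, c2, d1, d2] at this

end GradedLieData
namespace RootSystemBase

variable {V : Type*} [NormedAddCommGroup V] [InnerProductSpace ℝ V]

/-- integral Cartan matrix of type B -/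
def aB (ℓ i j : ℕ) : ℤ :=
  (if i = j then 2 else 0) + (if i = j - 1 then (if 2 ≤ j then (if j = ℓ then -2 else -1) else 0)
    else 0) + (if i = j + 1 then -1 else 0)

theorem matB_eq (ℓ : ℕ) {i j : ℕ} (hi : i ∈ Finset.Icc 1 ℓ) (hj : j ∈ Finset.Icc 1 ℓ) :
    matB ℓ i j = (aB ℓ i j : ℝ) := by
  simp only [Finset.mem_Icc] at hi hj
  unfold matB aB
  split_ifs <;> first | omega | norm_num

/-- coefficients of `e_k + e_{k+1}` -/
def fB (k i : ℕ) : ℤ := if i < k then 0 else if i = k then 1 else 2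

/-- coefficients of `e_k + e_{k+2}` -/
def gB (k i : ℕ) : ℤ := if i < k then 0 else if i ≤ k + 1 then 1 else 2

/-- coefficients of the sum of an interval of simple roots -/
def sI (i j k : ℕ) : ℤ := if i ≤ k ∧ k ≤ j then 1 else 0

theorem mem_congr {R : RootSystemBase V} {ℓ : ℕ} {α : ℕ → V} {c d : ℕ → ℤ}
    (hd : vec α ℓ d ∈ R.Δ) (h : ∀ i, 1 ≤ i → i ≤ ℓ → c i = d i) : vec α ℓ c ∈ R.Δ := by
  rw [vec_congr (d := d)]
  · exact hd
  · intro i hi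
    rw [Finset.mem_Icc] at hi
    exact h i hi.1 hi.2

section B
variable {R : RootSystemBase V} {ℓ : ℕ} {α : ℕ → V}

theorem prB (c : ℕ → ℤ) {j : ℕ} (h1 : 1 ≤ j) (h2 : j ≤ ℓ) :
    pr (aB ℓ) ℓ c j = 2 * c j - (if 2 ≤ j then (if j = ℓ then 2 else 1) * c (j - 1) else 0)
      - (if j + 1 ≤ ℓ then c (j + 1) else 0) := by
  unfold pr aB
  simp only [mul_add, Finset.sum_add_distrib, mul_ite, mul_zero, Finset.sum_ite_eq',
    Finset.mem_Icc]
  split_ifs <;> first | omega | ring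

theorem simple_memB (hT : R.Ty ℓ α (aB ℓ)) {j : ℕ} (h1 : 1 ≤ j) (h2 : j ≤ ℓ) :
    vec α ℓ (sI j j) ∈ R.Δ := by
  have hj : j ∈ Finset.Icc 1 ℓ := Finset.mem_Icc.2 ⟨h1, h2⟩
  have : vec α ℓ (Pi.single j 1) ∈ R.Δ := by rw [vec_single_one hj]; exact hT.mem hj
  refine mem_congr this fun i _ _ => ?_
  unfold sI
  by_cases h : i = j
  · subst h; simp
  · rw [if_neg (by omega)]; simp [h]

theorem sI_memB (hT : R.Ty ℓ α (aB ℓ)) (n : ℕ) : ∀ i j, i + n = j → 1 ≤ i → j ≤ ℓ →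
    vec α ℓ (sI i j) ∈ R.Δ := by
  induction n with
  | zero =>
    intro i j h h1 h2
    obtain rfl : i = j := by omega
    exact simple_memB hT h1 h2
  | succ n ih =>
    intro i j h h1 h2
    have h3 := ih (i + 1) j (by omega) (by omega) h2
    refine hT.refl_mem' h3 (j := i) (Finset.mem_Icc.2 ⟨h1, by omega⟩) (k := -1) ?_ ?_
    · rw [prB _ h1 (by omega)]
      unfold sI
      split_ifs <;> omega
    · intro k hk
      unfold sI
      split_ifs <;> omega

theorem fgB_mem (hT : R.Ty ℓ α (aB ℓ)) (n : ℕ) : ∀ k, k + n + 1 = ℓ → 1 ≤ k →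
    vec α ℓ (fB k) ∈ R.Δ ∧ (k + 2 ≤ ℓ → vec α ℓ (gB k) ∈ R.Δ) := by
  induction n with
  | zero =>
    intro k h h1
    refine ⟨?_, by omega⟩
    have h3 := simple_memB hT h1 (by omega : k ≤ ℓ)
    refine hT.refl_mem' h3 (j := ℓ) (Finset.mem_Icc.2 ⟨by omega, by omega⟩) (k := -2) ?_ ?_
    · rw [prB _ (by omega) le_rfl]
      unfold sI
      split_ifs <;> omega
    · intro i hi
      rw [Finset.mem_Icc] at hi
      unfold sI fB
      split_ifs <;> omega
  | succ n ih =>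
    intro k h h1
    have h3 := (ih (k + 1) (by omega) (by omega)).1
    have hg : vec α ℓ (gB k) ∈ R.Δ := by
      refine hT.refl_mem' h3 (j := k) (Finset.mem_Icc.2 ⟨h1, by omega⟩) (k := -1) ?_ ?_
      · rw [prB _ h1 (by omega)]
        unfold fB
        split_ifs <;> omega
      · intro i hi
        unfold fB gB
        split_ifs <;> omega
    refine ⟨?_, fun _ => hg⟩
    refine hT.refl_mem' hg (j := k + 1) (Finset.mem_Icc.2 ⟨by omega, by omega⟩) (k := -1) ?_ ?_
    · rw [prB _ (by omega) (by omega)]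
      unfold gB
      split_ifs <;> omega
    · intro i hi
      unfold fB gB
      split_ifs <;> omega

theorem fB_mem (hT : R.Ty ℓ α (aB ℓ)) {k : ℕ} (h1 : 1 ≤ k) (h2 : k + 1 ≤ ℓ) :
    vec α ℓ (fB k) ∈ R.Δ := (fgB_mem hT (ℓ - 1 - k) k (by omega) h1).1

theorem gB_mem (hT : R.Ty ℓ α (aB ℓ)) {k : ℕ} (h1 : 1 ≤ k) (h2 : k + 2 ≤ ℓ) :
    vec α ℓ (gB k) ∈ R.Δ := (fgB_mem hT (ℓ - 1 - k) k (by omega) h1).2 h2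

theorem sB_mem (hT : R.Ty ℓ α (aB ℓ)) {i j : ℕ} (h1 : 1 ≤ i) (h : i ≤ j) (h2 : j ≤ ℓ) :
    vec α ℓ (sI i j) ∈ R.Δ := sI_memB hT (j - i) i j (by omega) h1 h2

theorem pr_wB (hl : 2 ≤ ℓ) {j : ℕ} (h1 : 1 ≤ j) (h2 : j ≤ ℓ) :
    pr (aB ℓ) ℓ (fB 1) j = if j = 2 then (if ℓ = 2 then 2 else 1) else 0 := by
  rw [prB _ h1 h2]
  unfold fB
  split_ifs <;> omega

theorem norm_stepB (hT : R.Ty ℓ α (aB ℓ)) {j : ℕ} (h1 : 1 ≤ j) (h2 : j + 1 ≤ ℓ) :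
    ⟪α j, α j⟫ = (if j + 1 = ℓ then 2 else 1) * ⟪α (j + 1), α (j + 1)⟫ := by
  have h := hT.norm_rel (i := j) (j := j + 1) (Finset.mem_Icc.2 ⟨h1, by omega⟩)
    (Finset.mem_Icc.2 ⟨by omega, h2⟩)
  have e1 : aB ℓ j (j + 1) = if j + 1 = ℓ then -2 else -1 := by
    unfold aB; split_ifs <;> omega
  have e2 : aB ℓ (j + 1) j = -1 := by
    unfold aB; split_ifs <;> omega
  rw [e1, e2] at h
  split_ifs at h ⊢ <;> push_cast at h <;> linarith

theorem norm_leB (hT : R.Ty ℓ α (aB ℓ)) (j : ℕ) (h1 : 1 ≤ j) (h2 : j ≤ ℓ) :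
    ⟪α j, α j⟫ ≤ ⟪α 1, α 1⟫ := by
  induction j, h1 using Nat.le_induction with
  | base => exact le_rfl
  | succ j h1 ih =>
    have h := norm_stepB hT h1 h2
    have h3 := ih (by omega)
    have := R.inner_self_pos (hT.mem (j := j + 1) (Finset.mem_Icc.2 ⟨by omega, h2⟩))
    split_ifs at h <;> linarith

theorem highestB (hT : R.Ty ℓ α (aB ℓ)) (hl : 2 ≤ ℓ) {θ : V} (hθ : R.IsHighest θ) :
    θ = vec α ℓ (fB 1) := by
  refine hT.highest_eq hθ (fB_mem hT le_rfl hl) ?_ ?_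
  · intro j hj
    rw [Finset.mem_Icc] at hj
    rw [pr_wB hl hj.1 hj.2]
    split_ifs <;> norm_num
  · intro j hj
    rw [Finset.mem_Icc] at hj
    refine (norm_leB hT j hj.1 hj.2).trans ?_
    rw [hT.norm_vec, Finset.sum_eq_single 2]
    · rw [pr_wB hl (by omega) hl]
      have := norm_stepB hT le_rfl hl
      have e : fB 1 2 = 2 := by simp [fB]
      rw [e, this]
      norm_num
      by_cases h : ℓ = 2
      · subst h; norm_num; linarith
      · rw [if_neg (by omega : ¬ 2 = ℓ), if_neg h]; norm_num
    · intro i hi hne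
      rw [Finset.mem_Icc] at hi
      rw [pr_wB hl hi.1 hi.2, if_neg hne]; norm_num
    · intro h; exact absurd (Finset.mem_Icc.2 ⟨by omega, hl⟩) h

theorem sum_ge {I : Finset ℕ} {w : ℕ → ℤ} (hw : ∀ i ∈ I, 0 ≤ w i) {J : Finset ℕ} (h : J ⊆ I) :
    ∑ i ∈ J, w i ≤ ∑ i ∈ I, w i :=
  Finset.sum_le_sum_of_subset_of_nonneg h fun i hi _ => hw i hi

theorem sum_ge2 {I : Finset ℕ} {w : ℕ → ℤ} (hw : ∀ i ∈ I, 0 ≤ w i) {a b : ℕ} (ha : a ∈ I)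
    (hb : b ∈ I) (hab : a ≠ b) : w a + w b ≤ ∑ i ∈ I, w i := by
  have := sum_ge hw (J := {a, b}) (by
    intro x hx; simp at hx; rcases hx with rfl | rfl <;> assumption)
  rwa [Finset.sum_pair hab] at this

theorem sum_ge3 {I : Finset ℕ} {w : ℕ → ℤ} (hw : ∀ i ∈ I, 0 ≤ w i) {a b c : ℕ} (ha : a ∈ I)
    (hb : b ∈ I) (hc : c ∈ I) (hab : a ≠ b) (hac : a ≠ c) (hbc : b ≠ c) :
    w a + w b + w c ≤ ∑ i ∈ I, w i := by
  have := sum_ge hw (J := {a, b, c}) (by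
    intro x hx; simp at hx; rcases hx with rfl | rfl | rfl <;> assumption)
  rw [Finset.sum_insert (by simp [hab, hac]), Finset.sum_pair hbc] at this
  linarith

theorem sum_ge4 {I : Finset ℕ} {w : ℕ → ℤ} (hw : ∀ i ∈ I, 0 ≤ w i) {a b c d : ℕ} (ha : a ∈ I)
    (hb : b ∈ I) (hc : c ∈ I) (hd : d ∈ I) (hab : a ≠ b) (hac : a ≠ c) (hbc : b ≠ c)
    (had : a ≠ d) (hbd : b ≠ d) (hcd : c ≠ d) :
    w a + w b + w c + w d ≤ ∑ i ∈ I, w i := by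
  have := sum_ge hw (J := {a, b, c, d}) (by
    intro x hx; simp at hx; rcases hx with rfl | rfl | rfl | rfl <;> assumption)
  rw [Finset.sum_insert (by simp [hab, hac, had]), Finset.sum_insert (by simp [hbc, hbd]),
    Finset.sum_pair hcd] at this
  linarith

theorem eq_pair {I : Finset ℕ} {a b : ℕ} (ha : a ∈ I) (hb : b ∈ I)
    (h : ∀ x ∈ I, x = a ∨ x = b) : I = {a, b} := by
  ext x
  simp only [Finset.mem_insert, Finset.mem_singleton]
  exact ⟨h x, by rintro (rfl | rfl) <;> assumption⟩

theorem rigidB (hT : R.Ty ℓ α (aB ℓ)) (hl : 4 ≤ ℓ) {I : Finset ℕ} (hI : I ⊆ Finset.Icc 1 ℓ)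
    (h : R.NonRigid (I.image α) (vec α ℓ (fB 1))) :
    (∃ k, I = {k}) ∨ I = {1, 2} ∨ I = {2, 3} := by
  rw [hT.nonRigid_iff hI (fB_mem hT le_rfl (by omega))] at h
  obtain ⟨i, hi, j, hj, hij, h1, h2⟩ := h
  by_cases hs : ∀ x ∈ I, x = i
  · left
    refine ⟨i, ?_⟩
    ext x
    simp only [Finset.mem_singleton]
    exact ⟨hs x, by rintro rfl; exact hi⟩
  push Not at hs
  obtain ⟨x, hx, hxi⟩ := hs
  right
  have hw : ∀ i ∈ I, 0 ≤ fB 1 i := by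
    intro i _; unfold fB; split_ifs <;> norm_num
  have hwv : ∀ i ∈ I, fB 1 i = if i = 1 then 1 else 2 := by
    intro i hi
    have := Finset.mem_Icc.1 (hI hi)
    unfold fB; split_ifs <;> omega
  have hi' := Finset.mem_Icc.1 (hI hi)
  have hj' := Finset.mem_Icc.1 hj
  have hx' := Finset.mem_Icc.1 (hI hx)
  rw [pr_wB (by omega) hi'.1 hi'.2, pr_wB (by omega) hj'.1 hj'.2] at h2
  have g2 := sum_ge2 hw hi hx hxi.symm
  have g3 : ∀ y ∈ I, y ≠ i → y ≠ x → fB 1 i + fB 1 x + fB 1 y ≤ ∑ k ∈ I, fB 1 k := by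
    intro y hy h3 h4
    exact sum_ge3 hw hi hx hy hxi.symm h3.symm h4.symm
  set H := ∑ k ∈ I, fB 1 k with hH
  rw [hwv i hi, hwv x hx] at g2
  have hA : aB ℓ j i = if j + 1 = i then (if i = ℓ then -2 else -1) else if j = i + 1 then -1
      else 0 := by
    unfold aB; split_ifs <;> omega
  rw [hA] at h1 h2
  have hH4 : H ≤ 4 := by
    split_ifs at h1 h2 <;> omega
  have hall : ∀ y ∈ I, y = i ∨ y = x := by
    intro y hy
    by_contra hcon
    push Not at hcon
    have g := g3 y hy hcon.1 hcon.2
    rw [hwv i hi, hwv x hx, hwv y hy] at g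
    split_ifs at g <;> omega
  have hIx := eq_pair hi hx hall
  have hjI : j ∈ I ↔ j = x := by
    constructor
    · intro h
      rcases hall j h with h | h
      · exact absurd h.symm hij
      · exact h
    · rintro rfl; exact hx
  simp only [hjI] at h1 h2
  have hfin : (i = 1 ∧ x = 2) ∨ (i = 2 ∧ x = 1) ∨ (i = 2 ∧ x = 3) ∨ (i = 3 ∧ x = 2) := by
    clear hwv hw g3 hall hA hjI hIx
    split_ifs at h1 h2 g2 <;> omega
  rcases hfin with ⟨rfl, rfl⟩ | ⟨rfl, rfl⟩ | ⟨rfl, rfl⟩ | ⟨rfl, rfl⟩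
  · exact Or.inl hIx
  · exact Or.inl (hIx.trans (Finset.pair_comm _ _))
  · exact Or.inr hIx
  · exact Or.inr (hIx.trans (Finset.pair_comm _ _))

end B

end RootSystemBase
namespace RootSystemBase

variable {V : Type*} [NormedAddCommGroup V] [InnerProductSpace ℝ V]
variable {R : RootSystemBase V} {α : ℕ → V}

/-- positive roots of `B₂` -/
def lst2 (x y : ℤ) : Prop :=
  (x = 1 ∧ y = 0) ∨ (x = 0 ∧ y = 1) ∨ (x = 1 ∧ y = 1) ∨ (x = 1 ∧ y = 2)

/-- positive roots of `B₃` -/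
def lst3 (x y z : ℤ) : Prop :=
  (x = 1 ∧ y = 0 ∧ z = 0) ∨ (x = 0 ∧ y = 1 ∧ z = 0) ∨ (x = 0 ∧ y = 0 ∧ z = 1) ∨
  (x = 1 ∧ y = 1 ∧ z = 0) ∨ (x = 0 ∧ y = 1 ∧ z = 1) ∨ (x = 1 ∧ y = 1 ∧ z = 1) ∨
  (x = 0 ∧ y = 1 ∧ z = 2) ∨ (x = 1 ∧ y = 1 ∧ z = 2) ∨ (x = 1 ∧ y = 2 ∧ z = 2)

theorem mem2_of_lst (hT : R.Ty 2 α (aB 2)) {c : ℕ → ℤ} (h : lst2 (c 1) (c 2)) :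
    vec α 2 c ∈ R.Δ := by
  rcases h with h | h | h | h
  · refine mem_congr (sB_mem hT (i := 1) (j := 1) (by omega) (by omega) (by omega)) ?_
    intro i h1 h2; interval_cases i <;> simp [sI, h]
  · refine mem_congr (sB_mem hT (i := 2) (j := 2) (by omega) (by omega) (by omega)) ?_
    intro i h1 h2; interval_cases i <;> simp [sI, h]
  · refine mem_congr (sB_mem hT (i := 1) (j := 2) (by omega) (by omega) (by omega)) ?_
    intro i h1 h2; interval_cases i <;> simp [sI, h]
  · refine mem_congr (fB_mem hT (k := 1) (by omega) (by omega)) ?_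
    intro i h1 h2; interval_cases i <;> simp [fB, h]

theorem mem3_of_lst (hT : R.Ty 3 α (aB 3)) {c : ℕ → ℤ} (h : lst3 (c 1) (c 2) (c 3)) :
    vec α 3 c ∈ R.Δ := by
  rcases h with h | h | h | h | h | h | h | h | h
  · refine mem_congr (sB_mem hT (i := 1) (j := 1) (by omega) (by omega) (by omega)) ?_
    intro i h1 h2; interval_cases i <;> simp [sI, h]
  · refine mem_congr (sB_mem hT (i := 2) (j := 2) (by omega) (by omega) (by omega)) ?_
    intro i h1 h2; interval_cases i <;> simp [sI, h]
  · refine mem_congr (sB_mem hT (i := 3) (j := 3) (by omega) (by omega) (by omega)) ?_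
    intro i h1 h2; interval_cases i <;> simp [sI, h]
  · refine mem_congr (sB_mem hT (i := 1) (j := 2) (by omega) (by omega) (by omega)) ?_
    intro i h1 h2; interval_cases i <;> simp [sI, h]
  · refine mem_congr (sB_mem hT (i := 2) (j := 3) (by omega) (by omega) (by omega)) ?_
    intro i h1 h2; interval_cases i <;> simp [sI, h]
  · refine mem_congr (sB_mem hT (i := 1) (j := 3) (by omega) (by omega) (by omega)) ?_
    intro i h1 h2; interval_cases i <;> simp [sI, h]
  · refine mem_congr (fB_mem hT (k := 2) (by omega) (by omega)) ?_
    intro i h1 h2; interval_cases i <;> simp [fB, h]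
  · refine mem_congr (gB_mem hT (k := 1) (by omega) (by omega)) ?_
    intro i h1 h2; interval_cases i <;> simp [gB, h]
  · refine mem_congr (fB_mem hT (k := 1) (by omega) (by omega)) ?_
    intro i h1 h2; interval_cases i <;> simp [fB, h]

theorem lst2_of_mem (hT : R.Ty 2 α (aB 2)) (hθ : R.IsHighest (vec α 2 (fB 1))) {c : ℕ → ℤ}
    (hc : vec α 2 c ∈ R.Δ) (hp : 0 < c 1 ∨ 0 < c 2) : lst2 (c 1) (c 2) := by
  have m1 : 1 ∈ Finset.Icc 1 2 := by simp
  have m2 : 2 ∈ Finset.Icc 1 2 := by simp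
  have bd : ∀ d : ℕ → ℤ, vec α 2 d ∈ R.Δ → d 1 ≤ 1 ∧ d 2 ≤ 2 ∧
      ((0 ≤ d 1 ∧ 0 ≤ d 2) ∨ (d 1 ≤ 0 ∧ d 2 ≤ 0)) := by
    intro d hd
    refine ⟨highest_bound hT hθ hd m1, highest_bound hT hθ hd m2, ?_⟩
    rcases hT.sign hd with h | h
    · exact Or.inl ⟨h 1 m1, h 2 m2⟩
    · exact Or.inr ⟨h 1 m1, h 2 m2⟩
  have b0 := bd c hc
  have b1 := bd _ (hT.refl_mem hc m1)
  have b2 := bd _ (hT.refl_mem hc m2)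
  rw [prB _ (by omega) (by omega)] at b1 b2
  simp at b1 b2
  unfold lst2
  omega

theorem lst3_of_mem (hT : R.Ty 3 α (aB 3)) (hθ : R.IsHighest (vec α 3 (fB 1))) {c : ℕ → ℤ}
    (hc : vec α 3 c ∈ R.Δ) (hp : 0 < c 1 ∨ 0 < c 2 ∨ 0 < c 3) : lst3 (c 1) (c 2) (c 3) := by
  have m1 : 1 ∈ Finset.Icc 1 3 := by simp
  have m2 : 2 ∈ Finset.Icc 1 3 := by simp
  have m3 : 3 ∈ Finset.Icc 1 3 := by simp
  have bd : ∀ d : ℕ → ℤ, vec α 3 d ∈ R.Δ → d 1 ≤ 1 ∧ d 2 ≤ 2 ∧ d 3 ≤ 2 ∧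
      ((0 ≤ d 1 ∧ 0 ≤ d 2 ∧ 0 ≤ d 3) ∨ (d 1 ≤ 0 ∧ d 2 ≤ 0 ∧ d 3 ≤ 0)) := by
    intro d hd
    refine ⟨highest_bound hT hθ hd m1, highest_bound hT hθ hd m2, highest_bound hT hθ hd m3, ?_⟩
    rcases hT.sign hd with h | h
    · exact Or.inl ⟨h 1 m1, h 2 m2, h 3 m3⟩
    · exact Or.inr ⟨h 1 m1, h 2 m2, h 3 m3⟩
  have b0 := bd c hc
  have b1 := bd _ (hT.refl_mem hc m1)
  have b2 := bd _ (hT.refl_mem hc m2)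
  have b21 := bd _ (hT.refl_mem (hT.refl_mem hc m2) m1)
  have b3 := bd _ (hT.refl_mem hc m3)
  rw [prB _ (by omega) (by omega)] at b1 b2 b3
  rw [prB _ (by omega) (by omega), prB _ (by omega) (by omega)] at b21
  simp at b1 b2 b3 b21
  unfold lst3
  clear bd hc hθ hT
  generalize c 1 = x at *
  generalize c 2 = y at *
  generalize c 3 = z at *
  obtain ⟨hx, hy, hz, hs⟩ := b0
  have hs' : 0 ≤ x ∧ 0 ≤ y ∧ 0 ≤ z := by omega
  clear hs
  obtain ⟨h1, h2, h3⟩ := hs'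
  interval_cases x <;> interval_cases y <;> interval_cases z <;> omega

theorem lst3_23 {x y z : ℤ} (h : lst3 x y z) (h1 : y + z = 1)
    (hn : x ≠ 0 ∨ y ≠ 0 ∨ z ≠ 1) : y = 1 ∧ z = 0 := by
  rcases h with ⟨rfl, rfl, rfl⟩ | ⟨rfl, rfl, rfl⟩ | ⟨rfl, rfl, rfl⟩ | ⟨rfl, rfl, rfl⟩ |
    ⟨rfl, rfl, rfl⟩ | ⟨rfl, rfl, rfl⟩ | ⟨rfl, rfl, rfl⟩ | ⟨rfl, rfl, rfl⟩ | ⟨rfl, rfl, rfl⟩ <;>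
  simp at *

theorem lst3_23' {x y z : ℤ} (h : lst3 x y z) (h1 : y = 1 ∧ z = 0) : lst3 x y (z + 1) := by
  obtain ⟨rfl, rfl⟩ := h1
  unfold lst3 at *
  simp at *
  omega

theorem lst3_23'' {x y z : ℤ} (h : lst3 x y z) (h1 : y + z = 2) : lst3 x y (z - 1) := by
  rcases h with ⟨rfl, rfl, rfl⟩ | ⟨rfl, rfl, rfl⟩ | ⟨rfl, rfl, rfl⟩ | ⟨rfl, rfl, rfl⟩ |
    ⟨rfl, rfl, rfl⟩ | ⟨rfl, rfl, rfl⟩ | ⟨rfl, rfl, rfl⟩ | ⟨rfl, rfl, rfl⟩ | ⟨rfl, rfl, rfl⟩ <;>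
  simp [lst3] at *

theorem lst3_123 {x y z : ℤ} (h : lst3 x y z) (h1 : x + y + z = 1)
    (hn : x ≠ 0 ∨ y ≠ 1 ∨ z ≠ 0) : (x = 1 ∧ y = 0 ∧ z = 0) ∨ (x = 0 ∧ y = 0 ∧ z = 1) := by
  rcases h with ⟨rfl, rfl, rfl⟩ | ⟨rfl, rfl, rfl⟩ | ⟨rfl, rfl, rfl⟩ | ⟨rfl, rfl, rfl⟩ |
    ⟨rfl, rfl, rfl⟩ | ⟨rfl, rfl, rfl⟩ | ⟨rfl, rfl, rfl⟩ | ⟨rfl, rfl, rfl⟩ | ⟨rfl, rfl, rfl⟩ <;>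
  simp at *

theorem lst3_123'' {x y z : ℤ} (h : lst3 x y z) (h1 : x + y + z = 2) : lst3 x (y - 1) z := by
  rcases h with ⟨rfl, rfl, rfl⟩ | ⟨rfl, rfl, rfl⟩ | ⟨rfl, rfl, rfl⟩ | ⟨rfl, rfl, rfl⟩ |
    ⟨rfl, rfl, rfl⟩ | ⟨rfl, rfl, rfl⟩ | ⟨rfl, rfl, rfl⟩ | ⟨rfl, rfl, rfl⟩ | ⟨rfl, rfl, rfl⟩ <;>
  simp [lst3] at *

end RootSystemBase

namespace GradedLieData
open RootSystemBase
variable {V : Type*} [NormedAddCommGroup V] [InnerProductSpace ℝ V]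
variable {L : Type*} [LieRing L] [LieAlgebra ℂ L] [FiniteDimensional ℂ L]
variable {G : GradedLieData V L} {ℓ : ℕ} {α : ℕ → V} {A : ℕ → ℕ → ℤ}

/-- coordinate version of the Monge criterion -/
theorem monge_of_coords (hT : G.base.Ty ℓ α A) {I : Finset ℕ} (hI : I ⊆ Finset.Icc 1 ℓ)
    (b e : ℕ → ℤ) (hb : vec α ℓ b ∈ G.base.Δ) (hb1 : ∑ i ∈ I, b i = 1)
    (he : vec α ℓ e ∈ G.base.Δ) (he1 : ∑ i ∈ I, e i = 1)
    (hne : ∃ i ∈ Finset.Icc 1 ℓ, e i ≠ b i)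
    (h1 : ∀ c, vec α ℓ c ∈ G.base.Δ → ∑ i ∈ I, c i = 1 → (∃ i ∈ Finset.Icc 1 ℓ, c i ≠ b i) →
      vec α ℓ (c + b) ∈ G.base.Δ)
    (h2 : ∀ c, vec α ℓ c ∈ G.base.Δ → ∑ i ∈ I, c i = 2 → vec α ℓ (c - b) ∈ G.base.Δ)
    (h3 : ∀ c d, vec α ℓ c ∈ G.base.Δ → vec α ℓ d ∈ G.base.Δ → ∑ i ∈ I, c i = 1 →
      ∑ i ∈ I, d i = 1 → (∃ i ∈ Finset.Icc 1 ℓ, c i ≠ b i) → (∃ i ∈ Finset.Icc 1 ℓ, d i ≠ b i) →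
      (∃ i ∈ Finset.Icc 1 ℓ, c i ≠ d i) → vec α ℓ (c + d) ∉ G.base.Δ) :
    G.Monge (I.image α) := by
  have hn : ∀ {c d : ℕ → ℤ}, vec α ℓ c ≠ vec α ℓ d → ∃ i ∈ Finset.Icc 1 ℓ, c i ≠ d i := by
    intro c d h
    by_contra hcon
    push Not at hcon
    exact h (vec_congr hcon)
  refine G.monge_of_star (hT.image_sub hI) (vec α ℓ b) hb ?_ ⟨vec α ℓ e, he, ?_, ?_⟩ ?_ ?_ ?_
  · rw [hT.ht_vec hI hb, hb1]
  · rw [hT.ht_vec hI he, he1]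
  · intro h
    obtain ⟨i, hi, hh⟩ := hne
    exact hh (hT.vec_inj h i hi)
  · intro γ hγ k1 k2
    obtain ⟨c, rfl⟩ := hT.exists_vec hγ
    rw [hT.ht_vec hI hγ] at k1
    rw [← vec_add]
    exact h1 c hγ k1 (hn k2)
  · intro γ hγ k1
    obtain ⟨c, rfl⟩ := hT.exists_vec hγ
    rw [hT.ht_vec hI hγ] at k1
    rw [← vec_sub]
    exact h2 c hγ k1
  · intro γ hγ δ hδ k1 k2 n1 n2 n3
    obtain ⟨c, rfl⟩ := hT.exists_vec hγ
    obtain ⟨d, rfl⟩ := hT.exists_vec hδ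
    rw [hT.ht_vec hI hγ] at k1
    rw [hT.ht_vec hI hδ] at k2
    rw [← vec_add]
    exact h3 c d hγ hδ k1 k2 (hn n1) (hn n2) (hn n3)

theorem monge_B2 (hT : G.base.Ty 2 α (aB 2)) (hθ : G.base.IsHighest (vec α 2 (fB 1))) :
    G.Monge (({2} : Finset ℕ).image α) := by
  have ic : ∀ c d : ℕ → ℤ, (∃ i ∈ Finset.Icc 1 2, c i ≠ d i) → c 1 ≠ d 1 ∨ c 2 ≠ d 2 := by
    rintro c d ⟨i, hi, h⟩
    rw [Finset.mem_Icc] at hi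
    obtain ⟨h1, h2⟩ := hi
    interval_cases i <;> tauto
  refine monge_of_coords hT (by simp) (sI 2 2) (sI 1 2) ?_ ?_ ?_ ?_ ⟨1, by simp, by simp [sI]⟩
    ?_ ?_ ?_
  · exact sB_mem hT (by omega) (by omega) (by omega)
  · simp [sI, -Finset.sum_boole]
  · exact sB_mem hT (by omega) (by omega) (by omega)
  · simp [sI, -Finset.sum_boole]
  · intro c hc h1 h2
    have h2 := ic _ _ h2
    simp [sI] at h1 h2
    have := lst2_of_mem hT hθ hc (by omega)
    apply mem2_of_lst hT
    simp [sI]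
    unfold lst2 at *
    omega
  · intro c hc h1
    simp at h1
    have := lst2_of_mem hT hθ hc (by omega)
    apply mem2_of_lst hT
    simp [sI]
    unfold lst2 at *
    omega
  · intro c d hc hd h1 h2 n1 n2 n3 hm
    have n1 := ic _ _ n1
    have n2 := ic _ _ n2
    have n3 := ic _ _ n3
    simp [sI] at h1 h2 n1 n2 n3
    have k1 := lst2_of_mem hT hθ hc (by omega)
    have k2 := lst2_of_mem hT hθ hd (by omega)
    unfold lst2 at *
    omega

theorem monge_B3 (hT : G.base.Ty 3 α (aB 3)) (hθ : G.base.IsHighest (vec α 3 (fB 1))) :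
    G.Monge (({2, 3} : Finset ℕ).image α) ∧ G.Monge (({1, 2, 3} : Finset ℕ).image α) := by
  have ic : ∀ c d : ℕ → ℤ, (∃ i ∈ Finset.Icc 1 3, c i ≠ d i) →
      c 1 ≠ d 1 ∨ c 2 ≠ d 2 ∨ c 3 ≠ d 3 := by
    rintro c d ⟨i, hi, h⟩
    rw [Finset.mem_Icc] at hi
    obtain ⟨h1, h2⟩ := hi
    interval_cases i <;> tauto
  constructor
  · refine monge_of_coords hT (by decide) (sI 3 3) (sI 2 2) ?_ ?_ ?_ ?_
      ⟨2, by simp, by simp [sI]⟩ ?_ ?_ ?_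
    · exact sB_mem hT (by omega) (by omega) (by omega)
    · simp [sI, -Finset.sum_boole]
    · exact sB_mem hT (by omega) (by omega) (by omega)
    · simp [sI, -Finset.sum_boole]
    · intro c hc h1 h2
      have h2 := ic _ _ h2
      simp [sI] at h1 h2
      have k := lst3_of_mem hT hθ hc (by omega)
      apply mem3_of_lst hT
      simp [sI]
      exact lst3_23' k (lst3_23 k h1 (by omega))
    · intro c hc h1
      simp at h1
      have k := lst3_of_mem hT hθ hc (by omega)
      apply mem3_of_lst hT
      simp [sI]
      exact lst3_23'' k h1
    · intro c d hc hd h1 h2 n1 n2 n3 hm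
      have n1 := ic _ _ n1
      have n2 := ic _ _ n2
      have n3 := ic _ _ n3
      simp [sI] at h1 h2 n1 n2
      have k1 := lst3_of_mem hT hθ hc (by omega)
      have k2 := lst3_of_mem hT hθ hd (by omega)
      have e1 := lst3_23 k1 h1 (by omega)
      have e2 := lst3_23 k2 h2 (by omega)
      have k3 := lst3_of_mem hT hθ hm (by simp; omega)
      unfold lst3 at k1 k2 k3
      simp [e1, e2] at k1 k2 k3 n3
  · have e3 : ∀ c : ℕ → ℤ, ∑ i ∈ ({1, 2, 3} : Finset ℕ), c i = c 1 + c 2 + c 3 := by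
      intro c
      simp [add_assoc]
    refine monge_of_coords hT (by decide) (sI 2 2) (sI 3 3) ?_ ?_ ?_ ?_
      ⟨2, by simp, by simp [sI]⟩ ?_ ?_ ?_
    · exact sB_mem hT (by omega) (by omega) (by omega)
    · simp [sI, -Finset.sum_boole]
    · exact sB_mem hT (by omega) (by omega) (by omega)
    · simp [sI, -Finset.sum_boole]
    · intro c hc h1 h2
      have h2 := ic _ _ h2
      rw [e3] at h1
      simp [sI] at h2
      have k := lst3_of_mem hT hθ hc (by omega)
      apply mem3_of_lst hT
      simp [sI]
      rcases lst3_123 k h1 (by omega) with h | h <;> simp [lst3, h]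
    · intro c hc h1
      rw [e3] at h1
      have k := lst3_of_mem hT hθ hc (by omega)
      apply mem3_of_lst hT
      simp [sI]
      exact lst3_123'' k h1
    · intro c d hc hd h1 h2 n1 n2 n3 hm
      have n1 := ic _ _ n1
      have n2 := ic _ _ n2
      have n3 := ic _ _ n3
      rw [e3] at h1 h2
      simp [sI] at n1 n2
      have k1 := lst3_of_mem hT hθ hc (by omega)
      have k2 := lst3_of_mem hT hθ hd (by omega)
      have k3 := lst3_of_mem hT hθ hm (by simp; omega)
      rcases lst3_123 k1 h1 (by omega) with h | h <;>
      rcases lst3_123 k2 h2 (by omega) with h' | h' <;>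
      simp [lst3, h, h'] at k3 n3

/-- singletons are never of Monge type, except `B₂{α₂}` -/
theorem single_B (hT : G.base.Ty ℓ α (aB ℓ)) (hl : 2 ≤ ℓ)
    (hθ : G.base.IsHighest (vec α ℓ (fB 1))) {k : ℕ} (h1 : 1 ≤ k) (h2 : k ≤ ℓ)
    (hM : G.Monge (({k} : Finset ℕ).image α)) : ℓ = 2 ∧ k = 2 := by
  have hk : k ∈ Finset.Icc 1 ℓ := Finset.mem_Icc.2 ⟨h1, h2⟩
  have hI : ({k} : Finset ℕ) ⊆ Finset.Icc 1 ℓ := by simpa using hk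
  have hmem : ∀ j, 1 ≤ j → j ≤ ℓ → j ∈ Finset.Icc 1 ℓ := fun j a b => Finset.mem_Icc.2 ⟨a, b⟩
  by_contra hcon
  by_cases hk1 : k = 1
  · exact not_monge_single hT hθ hk (by simp [fB, hk1]) hM
  by_cases hkl : k < ℓ
  · refine not_monge_edges hT hI (sI k k) (gB (k - 1)) (sI (k - 1) k) (fB k) ?_ ?_ ?_ ?_ ?_ ?_
      ?_ ?_ ?_ ?_ ?_ ?_ ?_ ?_ ?_ ?_ hM
    · exact sB_mem hT (by omega) (by omega) (by omega)
    · exact gB_mem hT (by omega) (by omega)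
    · exact sB_mem hT (by omega) (by omega) (by omega)
    · exact fB_mem hT (by omega) (by omega)
    · refine mem_congr (fB_mem hT (k := k - 1) (by omega) (by omega)) fun i _ _ => ?_
      simp only [Pi.add_apply]
      unfold sI gB fB
      split_ifs <;> omega
    · refine mem_congr (fB_mem hT (k := k - 1) (by omega) (by omega)) fun i _ _ => ?_
      simp only [Pi.add_apply]
      unfold sI fB
      split_ifs <;> omega
    · simp [sI, -Finset.sum_boole]
    · rw [Finset.sum_singleton]; unfold gB; split_ifs <;> omega
    · simp [sI, -Finset.sum_boole]
    · simp [fB]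
    · refine ⟨k - 1, hmem _ (by omega) (by omega), ?_⟩
      unfold sI; split_ifs <;> omega
    · refine ⟨k + 1, hmem _ (by omega) (by omega), ?_⟩
      unfold sI fB; split_ifs <;> omega
    · refine ⟨k + 1, hmem _ (by omega) (by omega), ?_⟩
      unfold sI gB; split_ifs <;> omega
    · refine ⟨k - 1, hmem _ (by omega) (by omega), ?_⟩
      unfold fB gB; split_ifs <;> omega
    · refine ⟨k - 1, hmem _ (by omega) (by omega), ?_⟩
      unfold sI gB; split_ifs <;> omega
    · refine ⟨k - 1, hmem _ (by omega) (by omega), ?_⟩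
      unfold sI fB; split_ifs <;> omega
  · obtain rfl : k = ℓ := by omega
    refine not_monge_triangle hT hI (sI k k) (sI (k - 1) k) (sI (k - 2) k) ?_ ?_ ?_ ?_ ?_ ?_
      ?_ ?_ ?_ ?_ ?_ ?_ hM
    · exact sB_mem hT (by omega) (by omega) (by omega)
    · exact sB_mem hT (by omega) (by omega) (by omega)
    · exact sB_mem hT (by omega) (by omega) (by omega)
    · refine mem_congr (fB_mem hT (k := k - 1) (by omega) (by omega)) fun i _ _ => ?_
      simp only [Pi.add_apply]
      unfold sI fB
      split_ifs <;> omega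
    · refine mem_congr (gB_mem hT (k := k - 2) (by omega) (by omega)) fun i _ _ => ?_
      simp only [Pi.add_apply]
      unfold sI gB
      split_ifs <;> omega
    · refine mem_congr (fB_mem hT (k := k - 2) (by omega) (by omega)) fun i _ _ => ?_
      simp only [Pi.add_apply]
      unfold sI fB
      split_ifs <;> omega
    · simp [sI, -Finset.sum_boole]
    · simp [sI, -Finset.sum_boole]
    · simp [sI, -Finset.sum_boole]
    · refine ⟨k - 1, hmem _ (by omega) (by omega), ?_⟩
      unfold sI; split_ifs <;> omega
    · refine ⟨k - 1, hmem _ (by omega) (by omega), ?_⟩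
      unfold sI; split_ifs <;> omega
    · refine ⟨k - 2, hmem _ (by omega) (by omega), ?_⟩
      unfold sI; split_ifs <;> omega

theorem two_three_B (hT : G.base.Ty ℓ α (aB ℓ)) (hl : 4 ≤ ℓ) :
    ¬ G.Monge (({2, 3} : Finset ℕ).image α) := by
  have hmem : ∀ j, 1 ≤ j → j ≤ ℓ → j ∈ Finset.Icc 1 ℓ := fun j a b => Finset.mem_Icc.2 ⟨a, b⟩
  have hI : ({2, 3} : Finset ℕ) ⊆ Finset.Icc 1 ℓ := by
    intro i hi
    simp at hi
    rw [Finset.mem_Icc]; omega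
  refine not_monge_edges hT hI (sI 2 2) (sI 3 3) (sI 1 2) (sI 3 4) ?_ ?_ ?_ ?_ ?_ ?_
      (by simp [sI, -Finset.sum_boole]) (by simp [sI, -Finset.sum_boole])
      (by simp [sI, -Finset.sum_boole]) (by simp [sI, -Finset.sum_boole])
      ⟨1, hmem _ (by omega) (by omega), by simp [sI]⟩
      ⟨2, hmem _ (by omega) (by omega), by simp [sI]⟩
      ⟨2, hmem _ (by omega) (by omega), by simp [sI]⟩
      ⟨4, hmem _ (by omega) (by omega), by simp [sI]⟩
      ⟨2, hmem _ (by omega) (by omega), by simp [sI]⟩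
      ⟨2, hmem _ (by omega) (by omega), by simp [sI]⟩
  · exact sB_mem hT (by omega) (by omega) (by omega)
  · exact sB_mem hT (by omega) (by omega) (by omega)
  · exact sB_mem hT (by omega) (by omega) (by omega)
  · exact sB_mem hT (by omega) (by omega) (by omega)
  · refine mem_congr (sB_mem hT (i := 2) (j := 3) (by omega) (by omega) (by omega)) fun i _ _ => ?_
    simp only [Pi.add_apply]
    unfold sI
    split_ifs <;> omega
  · refine mem_congr (sB_mem hT (i := 1) (j := 4) (by omega) (by omega) (by omega)) fun i _ _ => ?_
    simp only [Pi.add_apply]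
    unfold sI
    split_ifs <;> omega

theorem one_three_B (hT : G.base.Ty 3 α (aB 3)) :
    ¬ G.Monge (({1, 3} : Finset ℕ).image α) := by
  refine not_monge_edges hT (by decide) (sI 1 1) (sI 2 3) (sI 1 2) (sI 3 3) ?_ ?_ ?_ ?_ ?_ ?_
      (by simp [sI, -Finset.sum_boole]) (by simp [sI, -Finset.sum_boole])
      (by simp [sI, -Finset.sum_boole]) (by simp [sI, -Finset.sum_boole])
      ⟨2, by simp, by simp [sI]⟩
      ⟨1, by simp, by simp [sI]⟩
      ⟨1, by simp, by simp [sI]⟩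
      ⟨2, by simp, by simp [sI]⟩
      ⟨2, by simp, by simp [sI]⟩
      ⟨2, by simp, by simp [sI]⟩
  · exact sB_mem hT (by omega) (by omega) (by omega)
  · exact sB_mem hT (by omega) (by omega) (by omega)
  · exact sB_mem hT (by omega) (by omega) (by omega)
  · exact sB_mem hT (by omega) (by omega) (by omega)
  · refine mem_congr (sB_mem hT (i := 1) (j := 3) (by omega) (by omega) (by omega)) fun i _ _ => ?_
    simp only [Pi.add_apply]
    unfold sI
    split_ifs <;> omega
  · refine mem_congr (sB_mem hT (i := 1) (j := 3) (by omega) (by omega) (by omega)) fun i _ _ => ?_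
    simp only [Pi.add_apply]
    unfold sI
    split_ifs <;> omega

end GradedLieData
namespace RootSystemBase

variable {V : Type*} [NormedAddCommGroup V] [InnerProductSpace ℝ V]
variable {R : RootSystemBase V} {α : ℕ → V} {ℓ : ℕ} {A : ℕ → ℕ → ℤ}

theorem Ty.image_inj (hT : R.Ty ℓ α A) {I J : Finset ℕ} (hI : I ⊆ Finset.Icc 1 ℓ)
    (hJ : J ⊆ Finset.Icc 1 ℓ) : I.image α = J.image α ↔ I = J := by
  constructor
  · intro h
    ext i
    constructor
    · intro hi
      have : α i ∈ J.image α := h ▸ Finset.mem_image_of_mem _ hi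
      obtain ⟨j, hj, hij⟩ := Finset.mem_image.1 this
      rwa [← hT.inj (hJ hj) (hI hi) hij]
    · intro hi
      have : α i ∈ I.image α := h ▸ Finset.mem_image_of_mem _ hi
      obtain ⟨j, hj, hij⟩ := Finset.mem_image.1 this
      rwa [← hT.inj (hI hj) (hJ hi) hij]
  · rintro rfl; rfl

theorem Ty.exists_image (hT : R.Ty ℓ α A) {S : Finset V} (hS : S ⊆ R.Δ0) :
    ∃ I ⊆ Finset.Icc 1 ℓ, S = I.image α := by
  rw [hT.2.1] at hS
  obtain ⟨I, hI, h⟩ := Finset.subset_image_iff.1 hS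
  exact ⟨I, by exact_mod_cast hI, h.symm⟩

end RootSystemBase

namespace GradedLieData
open RootSystemBase
variable {V : Type*} [NormedAddCommGroup V] [InnerProductSpace ℝ V]
variable {L : Type*} [LieRing L] [LieAlgebra ℂ L] [FiniteDimensional ℂ L]
variable {G : GradedLieData V L} {ℓ : ℕ} {α : ℕ → V}

theorem mainB (hT : G.base.Ty ℓ α (aB ℓ)) (hl : 2 ≤ ℓ) {θ : V} (hθ : G.base.IsHighest θ)
    {I : Finset ℕ} (hI : I ⊆ Finset.Icc 1 ℓ) (hne : I.Nonempty) :
    (G.Monge (I.image α) ∧ G.base.NonRigid (I.image α) θ) ↔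
      ((ℓ = 2 ∧ I = {2}) ∨ (ℓ = 3 ∧ I = {2, 3}) ∨ (ℓ = 3 ∧ I = {1, 2, 3}) ∨ I = {1, 2}) := by
  obtain rfl := highestB hT hl hθ
  constructor
  · rintro ⟨hM, hN⟩
    have hsing : ∀ k, I = {k} → ℓ = 2 ∧ I = {2} := by
      rintro k rfl
      have := Finset.mem_Icc.1 (hI (Finset.mem_singleton_self k))
      obtain ⟨h1, rfl⟩ := single_B hT hl hθ this.1 this.2 hM
      exact ⟨h1, rfl⟩
    by_cases h4 : 4 ≤ ℓ
    · rcases rigidB hT h4 hI hN with ⟨k, hk⟩ | h | h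
      · exact Or.inl (hsing k hk)
      · exact Or.inr (Or.inr (Or.inr h))
      · rw [h] at hM
        exact absurd hM (two_three_B hT h4)
    · have hcl : ∀ I ∈ (Finset.Icc 1 3).powerset, I = ∅ ∨ I = {1} ∨ I = {2} ∨ I = {3} ∨
          I = {1, 2} ∨ I = {1, 3} ∨ I = {2, 3} ∨ I = {1, 2, 3} := by decide
      have hI3 : I ⊆ Finset.Icc 1 3 := by
        intro i hi
        have := Finset.mem_Icc.1 (hI hi)
        exact Finset.mem_Icc.2 (by omega)
      have h3 : 3 ∈ I → ℓ = 3 := by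
        intro h
        have := Finset.mem_Icc.1 (hI h)
        omega
      rcases hcl I (Finset.mem_powerset.2 hI3) with h | h | h | h | h | h | h | h
      · exact absurd h hne.ne_empty
      · exact Or.inl (hsing _ h)
      · exact Or.inl (hsing _ h)
      · exact Or.inl (hsing _ h)
      · exact Or.inr (Or.inr (Or.inr h))
      · obtain rfl := h3 (by simp [h])
        rw [h] at hM
        exact absurd hM (one_three_B hT)
      · exact Or.inr (Or.inl ⟨h3 (by simp [h]), h⟩)
      · exact Or.inr (Or.inr (Or.inl ⟨h3 (by simp [h]), h⟩))
  · rintro (⟨rfl, rfl⟩ | ⟨rfl, rfl⟩ | ⟨rfl, rfl⟩ | rfl)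
    · refine ⟨monge_B2 hT hθ, ?_⟩
      rw [hT.nonRigid_iff hI (fB_mem hT le_rfl (by omega))]
      refine ⟨2, by simp, 1, by simp, by simp, ?_, ?_⟩
      · simp [aB]
      · rw [pr_wB (by omega) (by omega) (by omega), pr_wB (by omega) (by omega) (by omega)]
        simp [aB, fB]
    · refine ⟨(monge_B3 hT hθ).1, ?_⟩
      rw [hT.nonRigid_iff hI (fB_mem hT le_rfl (by omega))]
      refine ⟨3, by simp, 2, by simp, by simp, ?_, ?_⟩
      · simp [aB]
      · rw [pr_wB (by omega) (by omega) (by omega), pr_wB (by omega) (by omega) (by omega)]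
        simp [aB, fB]
    · refine ⟨(monge_B3 hT hθ).2, ?_⟩
      rw [hT.nonRigid_iff hI (fB_mem hT le_rfl (by omega))]
      refine ⟨3, by simp, 2, by simp, by simp, ?_, ?_⟩
      · simp [aB]
      · rw [pr_wB (by omega) (by omega) (by omega), pr_wB (by omega) (by omega) (by omega)]
        simp [aB, fB]
    · refine ⟨monge_one_two hT hl hθ (by simp [fB]) ?_, ?_⟩
      · intro c
        rw [prB _ (by omega) (by omega)]
        simp [hl]
      · rw [hT.nonRigid_iff hI (fB_mem hT le_rfl (by omega))]
        have e : aB ℓ 2 1 = -1 := by simp [aB]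
        refine ⟨1, by simp, 2, by simp; omega, by simp, ?_, ?_⟩
        · simp [e]
        · rw [pr_wB (by omega) (by omega) (by omega), pr_wB (by omega) (by omega) (by omega), e]
          simp [fB]
          split_ifs <;> norm_num

end GradedLieData
namespace RootSystemBase

variable {V : Type*} [NormedAddCommGroup V] [InnerProductSpace ℝ V]

/-- integral Cartan matrix of type D -/
def aD (ℓ i j : ℕ) : ℤ :=
  (if i = j then 2 else 0) + (if i = j - 1 then (if 2 ≤ j ∧ j ≠ ℓ then -1 else 0) else 0) +
  (if i = j + 1 then (if j + 2 ≤ ℓ then -1 else 0) else 0) +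
  (if i = ℓ then (if j + 2 = ℓ then -1 else 0) else 0) +
  (if i = ℓ - 2 then (if j = ℓ then -1 else 0) else 0)

theorem matD_eq {ℓ : ℕ} (hl : 4 ≤ ℓ) {i j : ℕ} (hi : i ∈ Finset.Icc 1 ℓ)
    (hj : j ∈ Finset.Icc 1 ℓ) : matD ℓ i j = (aD ℓ i j : ℝ) := by
  simp only [Finset.mem_Icc] at hi hj
  unfold matD aD
  split_ifs <;> first | omega | norm_num

/-- coefficients of `e_k + e_{k+1}` -/
def fD (ℓ k i : ℕ) : ℤ :=
  if i < k then 0 else if i = k then 1 else if i + 2 ≤ ℓ then 2 else 1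

/-- coefficients of `e_k + e_{k+2}` -/
def gD (ℓ k i : ℕ) : ℤ :=
  if i < k then 0 else if i ≤ k + 1 then 1 else if i + 2 ≤ ℓ then 2 else 1

/-- coefficients of `e_k + e_ℓ` -/
def tD (ℓ k i : ℕ) : ℤ := if (k ≤ i ∧ i + 2 ≤ ℓ) ∨ i = ℓ then 1 else 0

section D
variable {R : RootSystemBase V} {ℓ : ℕ} {α : ℕ → V}

theorem prD (hl : 4 ≤ ℓ) (c : ℕ → ℤ) {j : ℕ} (h1 : 1 ≤ j) (h2 : j ≤ ℓ) :
    pr (aD ℓ) ℓ c j = 2 * c j - (if 2 ≤ j ∧ j ≠ ℓ then c (j - 1) else 0)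
      - (if j + 2 ≤ ℓ then c (j + 1) else 0) - (if j + 2 = ℓ then c ℓ else 0)
      - (if j = ℓ then c (ℓ - 2) else 0) := by
  unfold pr aD
  simp only [mul_add, Finset.sum_add_distrib, mul_ite, mul_zero, Finset.sum_ite_eq',
    Finset.mem_Icc]
  split_ifs <;> omega

theorem simple_memD (hT : R.Ty ℓ α (aD ℓ)) {j : ℕ} (h1 : 1 ≤ j) (h2 : j ≤ ℓ) :
    vec α ℓ (sI j j) ∈ R.Δ := by
  have hj : j ∈ Finset.Icc 1 ℓ := Finset.mem_Icc.2 ⟨h1, h2⟩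
  have : vec α ℓ (Pi.single j 1) ∈ R.Δ := by rw [vec_single_one hj]; exact hT.mem hj
  refine mem_congr this fun i _ _ => ?_
  unfold sI
  by_cases h : i = j
  · subst h; simp
  · rw [if_neg (by omega)]; simp [h]

theorem sI_memD (hT : R.Ty ℓ α (aD ℓ)) (hl : 4 ≤ ℓ) (n : ℕ) : ∀ i j, i + n = j → 1 ≤ i →
    j + 1 ≤ ℓ → vec α ℓ (sI i j) ∈ R.Δ := by
  induction n with
  | zero =>
    intro i j h h1 h2
    obtain rfl : i = j := by omega
    exact simple_memD hT h1 (by omega)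
  | succ n ih =>
    intro i j h h1 h2
    have h3 := ih (i + 1) j (by omega) (by omega) h2
    refine hT.refl_mem' h3 (j := i) (Finset.mem_Icc.2 ⟨h1, by omega⟩) (k := -1) ?_ ?_
    · rw [prD hl _ h1 (by omega)]
      unfold sI
      split_ifs <;> omega
    · intro k hk
      unfold sI
      split_ifs <;> omega

theorem sD_mem (hT : R.Ty ℓ α (aD ℓ)) (hl : 4 ≤ ℓ) {i j : ℕ} (h1 : 1 ≤ i) (h : i ≤ j)
    (h2 : j + 1 ≤ ℓ) : vec α ℓ (sI i j) ∈ R.Δ := sI_memD hT hl (j - i) i j (by omega) h1 h2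

theorem tD_memN (hT : R.Ty ℓ α (aD ℓ)) (hl : 4 ≤ ℓ) (n : ℕ) : ∀ k, k + n + 1 = ℓ → 1 ≤ k →
    vec α ℓ (tD ℓ k) ∈ R.Δ := by
  induction n with
  | zero =>
    intro k h h1
    refine mem_congr (simple_memD hT (j := ℓ) (by omega) le_rfl) fun i _ _ => ?_
    unfold tD sI
    split_ifs <;> omega
  | succ n ih =>
    intro k h h1
    have h3 := ih (k + 1) (by omega) (by omega)
    refine hT.refl_mem' h3 (j := k) (Finset.mem_Icc.2 ⟨h1, by omega⟩) (k := -1) ?_ ?_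
    · rw [prD hl _ h1 (by omega)]
      unfold tD
      split_ifs <;> omega
    · intro i hi
      unfold tD
      split_ifs <;> omega

theorem tD_mem (hT : R.Ty ℓ α (aD ℓ)) (hl : 4 ≤ ℓ) {k : ℕ} (h1 : 1 ≤ k) (h2 : k + 1 ≤ ℓ) :
    vec α ℓ (tD ℓ k) ∈ R.Δ := tD_memN hT hl (ℓ - 1 - k) k (by omega) h1

theorem sD_mem' (hT : R.Ty ℓ α (aD ℓ)) (hl : 4 ≤ ℓ) {k : ℕ} (h1 : 1 ≤ k) (h2 : k + 2 ≤ ℓ) :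
    vec α ℓ (sI k ℓ) ∈ R.Δ := by
  refine hT.refl_mem' (tD_mem hT hl h1 (by omega)) (j := ℓ - 1)
    (Finset.mem_Icc.2 ⟨by omega, by omega⟩) (k := -1) ?_ ?_
  · rw [prD hl _ (by omega) (by omega)]
    unfold tD
    split_ifs <;> omega
  · intro i hi
    rw [Finset.mem_Icc] at hi
    unfold tD sI
    split_ifs <;> omega

theorem fD_lt {k i : ℕ} (h : i < k) : fD ℓ k i = 0 := by unfold fD; rw [if_pos h]

theorem fD_self (k : ℕ) : fD ℓ k k = 1 := by unfold fD; rw [if_neg (by omega), if_pos rfl]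

theorem fD_mid {k i : ℕ} (h : k < i) (h2 : i + 2 ≤ ℓ) : fD ℓ k i = 2 := by
  unfold fD; rw [if_neg (by omega), if_neg (by omega), if_pos h2]

theorem fD_end {k i : ℕ} (h : k < i) (h2 : ℓ < i + 2) : fD ℓ k i = 1 := by
  unfold fD; rw [if_neg (by omega), if_neg (by omega), if_neg (by omega)]

theorem fgD_mem (hT : R.Ty ℓ α (aD ℓ)) (hl : 4 ≤ ℓ) (n : ℕ) : ∀ k, k + n + 2 = ℓ → 1 ≤ k →
    vec α ℓ (fD ℓ k) ∈ R.Δ ∧ (k + 3 ≤ ℓ → vec α ℓ (gD ℓ k) ∈ R.Δ) := by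
  induction n with
  | zero =>
    intro k h h1
    refine ⟨?_, by omega⟩
    refine mem_congr (sD_mem' hT hl (k := k) h1 (by omega)) fun i _ _ => ?_
    unfold fD sI
    split_ifs <;> omega
  | succ n ih =>
    intro k h h1
    have h3 := (ih (k + 1) (by omega) (by omega)).1
    have hg : vec α ℓ (gD ℓ k) ∈ R.Δ := by
      refine hT.refl_mem' h3 (j := k) (Finset.mem_Icc.2 ⟨h1, by omega⟩) (k := -1) ?_ ?_
      · rw [prD hl _ h1 (by omega), fD_lt (by omega), fD_lt (by omega), fD_self,
          if_pos (by omega : k + 2 ≤ ℓ), if_neg (by omega : ¬ k + 2 = ℓ),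
          if_neg (by omega : ¬ k = ℓ)]
        simp
      · intro i hi
        unfold fD gD
        split_ifs <;> omega
    refine ⟨?_, fun _ => hg⟩
    refine hT.refl_mem' hg (j := k + 1) (Finset.mem_Icc.2 ⟨by omega, by omega⟩) (k := -1) ?_ ?_
    · have e1 : gD ℓ k (k + 1) = 1 := by
        unfold gD; rw [if_neg (by omega), if_pos (by omega)]
      have e2 : gD ℓ k (k + 1 - 1) = 1 := by
        unfold gD; rw [if_neg (by omega), if_pos (by omega)]
      have e3 : gD ℓ k (k + 1 + 1) = if k + 4 ≤ ℓ then 2 else 1 := by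
        unfold gD; rw [if_neg (by omega), if_neg (by omega)]
      have e4 : gD ℓ k ℓ = 1 := by
        unfold gD; rw [if_neg (by omega), if_neg (by omega), if_neg (by omega)]
      rw [prD hl _ (by omega) (by omega), e1, e2, e3, e4,
        if_pos (by omega : 2 ≤ k + 1 ∧ k + 1 ≠ ℓ),
        if_pos (by omega : k + 1 + 2 ≤ ℓ), if_neg (by omega : ¬ k + 1 = ℓ)]
      split_ifs <;> omega
    · intro i hi
      unfold fD gD
      split_ifs <;> omega

theorem fD_mem (hT : R.Ty ℓ α (aD ℓ)) (hl : 4 ≤ ℓ) {k : ℕ} (h1 : 1 ≤ k) (h2 : k + 2 ≤ ℓ) :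
    vec α ℓ (fD ℓ k) ∈ R.Δ := (fgD_mem hT hl (ℓ - 2 - k) k (by omega) h1).1

theorem gD_mem (hT : R.Ty ℓ α (aD ℓ)) (hl : 4 ≤ ℓ) {k : ℕ} (h1 : 1 ≤ k) (h2 : k + 3 ≤ ℓ) :
    vec α ℓ (gD ℓ k) ∈ R.Δ := (fgD_mem hT hl (ℓ - 2 - k) k (by omega) h1).2 h2

theorem pr_wD (hl : 4 ≤ ℓ) {j : ℕ} (h1 : 1 ≤ j) (h2 : j ≤ ℓ) :
    pr (aD ℓ) ℓ (fD ℓ 1) j = if j = 2 then 1 else 0 := by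
  rw [prD hl _ h1 h2]
  by_cases c1 : j = 1
  · subst c1
    rw [fD_self, fD_mid (i := 1 + 1) (by omega) (by omega), if_neg (by omega), if_pos (by omega),
      if_neg (by omega), if_neg (by omega), if_neg (by omega)]
    norm_num
  by_cases c2 : j = 2
  · subst c2
    have e : fD ℓ 1 (2 + 1) = if ℓ = 4 then 1 else 2 := by
      by_cases h : ℓ = 4
      · rw [fD_end (by omega) (by omega), if_pos h]
      · rw [fD_mid (by omega) (by omega), if_neg h]
    rw [e, fD_mid (i := 2) (by omega) (by omega), show 2 - 1 = 1 from rfl, fD_self,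
      fD_end (i := ℓ) (by omega) (by omega), if_pos (by omega : 2 ≤ 2 ∧ 2 ≠ ℓ),
      if_pos (by omega : 2 + 2 ≤ ℓ), if_neg (by omega : ¬ 2 = ℓ)]
    split_ifs <;> omega
  have e1 : fD ℓ 1 ℓ = 1 := fD_end (by omega) (by omega)
  have e2 : fD ℓ 1 (ℓ - 2) = 2 := fD_mid (by omega) (by omega)
  rw [if_neg c2, e1, e2]
  by_cases c3 : j = ℓ
  · subst c3
    rw [e1, if_neg (by omega), if_neg (by omega), if_neg (by omega), if_pos rfl]
    norm_num
  rw [if_pos (by omega : 2 ≤ j ∧ j ≠ ℓ), if_neg c3, fD_mid (i := j - 1) (by omega) (by omega)]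
  by_cases c4 : j + 1 = ℓ
  · rw [fD_end (i := j) (by omega) (by omega), if_neg (by omega), if_neg (by omega)]
    norm_num
  rw [fD_mid (i := j) (by omega) (by omega), if_pos (by omega : j + 2 ≤ ℓ)]
  by_cases c5 : j + 2 = ℓ
  · rw [fD_end (i := j + 1) (by omega) (by omega), if_pos c5]
    norm_num
  · rw [fD_mid (i := j + 1) (by omega) (by omega), if_neg c5]
    norm_num

theorem norm_stepD (hT : R.Ty ℓ α (aD ℓ)) {i j : ℕ} (hi : i ∈ Finset.Icc 1 ℓ)
    (hj : j ∈ Finset.Icc 1 ℓ) (e1 : aD ℓ i j = -1) (e2 : aD ℓ j i = -1) :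
    ⟪α j, α j⟫ = ⟪α i, α i⟫ := by
  have h := hT.norm_rel hi hj
  rw [e1, e2] at h
  push_cast at h
  linarith

theorem norm_eqD1 (hT : R.Ty ℓ α (aD ℓ)) (hl : 4 ≤ ℓ) (j : ℕ) (h1 : 1 ≤ j) (h2 : j + 1 ≤ ℓ) :
    ⟪α j, α j⟫ = ⟪α 1, α 1⟫ := by
  induction j, h1 using Nat.le_induction with
  | base => rfl
  | succ j h1 ih =>
    rw [← ih (by omega)]
    refine norm_stepD hT (Finset.mem_Icc.2 ⟨h1, by omega⟩)
      (Finset.mem_Icc.2 ⟨by omega, by omega⟩) ?_ ?_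
    · unfold aD; split_ifs <;> omega
    · unfold aD; split_ifs <;> omega

theorem norm_eqD (hT : R.Ty ℓ α (aD ℓ)) (hl : 4 ≤ ℓ) (j : ℕ) (h1 : 1 ≤ j) (h2 : j ≤ ℓ) :
    ⟪α j, α j⟫ = ⟪α 1, α 1⟫ := by
  by_cases h : j + 1 ≤ ℓ
  · exact norm_eqD1 hT hl j h1 h
  · obtain rfl : j = ℓ := by omega
    rw [← norm_eqD1 hT hl (j - 2) (by omega) (by omega)]
    refine norm_stepD hT (Finset.mem_Icc.2 ⟨by omega, by omega⟩)
      (Finset.mem_Icc.2 ⟨by omega, by omega⟩) ?_ ?_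
    · unfold aD; split_ifs <;> omega
    · unfold aD; split_ifs <;> omega

theorem highestD (hT : R.Ty ℓ α (aD ℓ)) (hl : 4 ≤ ℓ) {θ : V} (hθ : R.IsHighest θ) :
    θ = vec α ℓ (fD ℓ 1) := by
  refine hT.highest_eq hθ (fD_mem hT hl le_rfl (by omega)) ?_ ?_
  · intro j hj
    rw [Finset.mem_Icc] at hj
    rw [pr_wD hl hj.1 hj.2]
    split_ifs <;> norm_num
  · intro j hj
    rw [Finset.mem_Icc] at hj
    rw [norm_eqD hT hl j hj.1 hj.2, hT.norm_vec, Finset.sum_eq_single 2]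
    · rw [pr_wD hl (by omega) (by omega), norm_eqD hT hl 2 (by omega) (by omega)]
      have e : fD ℓ 1 2 = 2 := by unfold fD; split_ifs <;> omega
      rw [e]
      norm_num
    · intro i hi hne
      rw [Finset.mem_Icc] at hi
      rw [pr_wD hl hi.1 hi.2, if_neg hne]; norm_num
    · intro h; exact absurd (Finset.mem_Icc.2 ⟨by omega, by omega⟩) h

theorem eq_triple {I : Finset ℕ} {a b c : ℕ} (ha : a ∈ I) (hb : b ∈ I) (hc : c ∈ I)
    (h : ∀ x ∈ I, x = a ∨ x = b ∨ x = c) : I = {a, b, c} := by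
  ext x
  simp only [Finset.mem_insert, Finset.mem_singleton]
  exact ⟨h x, by rintro (rfl | rfl | rfl) <;> assumption⟩

/-- the arithmetic of non-rigidity in type D -/
theorem rigidD_aux (hl : 4 ≤ ℓ) {I : Finset ℕ} (hI : I ⊆ Finset.Icc 1 ℓ) (f : ℕ → ℤ)
    (hf : ∀ i ∈ I, ((i = 1 ∨ i + 1 = ℓ ∨ i = ℓ) ∧ f i = 1) ∨
      (i ≠ 1 ∧ i + 1 ≠ ℓ ∧ i ≠ ℓ ∧ f i = 2))
    {i j : ℕ} (hi : i ∈ I) (hj : 1 ≤ j ∧ j ≤ ℓ) (hij : i ≠ j) {m u v : ℤ}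
    (hu : (i = 2 ∧ u = 1) ∨ (i ≠ 2 ∧ u = 0)) (hv : (j = 2 ∧ v = 1) ∨ (j ≠ 2 ∧ v = 0))
    (hm : 0 < m) (h2 : ∑ k ∈ I, f k ≤ u + (v + 1) * m)
    (hadj : ((j + 1 = i ∧ i ≠ ℓ) ∨ (i + 1 = j ∧ j ≠ ℓ) ∨ (j = ℓ ∧ i + 2 = ℓ) ∨
      (i = ℓ ∧ j + 2 = ℓ)) ∧ ((j ∈ I ∧ m = 2) ∨ (j ∉ I ∧ m = 1)) ∨ (j ∈ I ∧ m = 1)) :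
    (∃ k, I = {k}) ∨ (∃ x ∈ I, I = {i, x} ∧ i = 2 ∧ (x = 1 ∨ (ℓ = 4 ∧ (x = 3 ∨ x = 4)))) ∨
    (I = {2, i} ∧ (i = 1 ∨ i = 3 ∨ (ℓ = 4 ∧ i = 4))) ∨
    (∃ y, ((i = 1 ∧ (y + 1 = ℓ ∨ y = ℓ)) ∨ (ℓ = 4 ∧ i = 3 ∧ (y = 1 ∨ y = 4)) ∨
      (ℓ = 4 ∧ i = 4 ∧ (y = 1 ∨ y = 3))) ∧ (I = {i, y} ∨ I = {2, i, y})) := by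
  by_cases hs : ∀ x ∈ I, x = i
  · left
    refine ⟨i, ?_⟩
    ext x
    simp only [Finset.mem_singleton]
    exact ⟨hs x, by rintro rfl; exact hi⟩
  push Not at hs
  obtain ⟨x0, hx0, hxi0⟩ := hs
  right
  have hpos : ∀ i ∈ I, 1 ≤ f i := by
    intro i hi
    rcases hf i hi with h | h <;> omega
  have hw : ∀ i ∈ I, 0 ≤ f i := fun i hi => by have := hpos i hi; omega
  have g2 : ∀ x ∈ I, x ≠ i → f i + f x ≤ ∑ k ∈ I, f k := by
    intro x hx h
    exact sum_ge2 hw hi hx h.symm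
  have g3 : ∀ x ∈ I, ∀ y ∈ I, x ≠ i → y ≠ i → y ≠ x →
      f i + f x + f y ≤ ∑ k ∈ I, f k := by
    intro x hx y hy h2 h3 h4
    exact sum_ge3 hw hi hx hy h2.symm h3.symm h4.symm
  have g4 : ∀ x ∈ I, ∀ y ∈ I, ∀ z ∈ I, x ≠ i → y ≠ i → y ≠ x → z ≠ i → z ≠ x → z ≠ y →
      f i + f x + f y + f z ≤ ∑ k ∈ I, f k := by
    intro x hx y hy z hz h1 h2 h3 h4 h5 h6
    exact sum_ge4 hw hi hx hy hz h1.symm h2.symm h3.symm h4.symm h5.symm h6.symm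
  generalize ∑ k ∈ I, f k = H at *
  have hi' := Finset.mem_Icc.1 (hI hi)
  have hx0' := Finset.mem_Icc.1 (hI hx0)
  have gx0 := g2 x0 hx0 hxi0
  have fi := hf i hi
  have fx := hf x0 hx0
  have pi := hpos i hi
  have px := hpos x0 hx0
  -- if only two elements fit
  have pairI : ∀ x ∈ I, x ≠ i → H ≤ f i + f x → I = {i, x} := by
    intro x hx hxi hH
    refine eq_pair hi hx fun y hy => ?_
    by_contra hcon
    push Not at hcon
    have := g3 x hx y hy hxi hcon.1 hcon.2
    have := hpos y hy
    omega
  rcases hu with ⟨rfl, rfl⟩ | ⟨hi2, rfl⟩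
  · left
    have hv0 : v = 0 := by omega
    subst hv0
    have hjI : j ∈ I ∧ m = 2 ∧ ((j + 1 = 2 ∧ 2 ≠ ℓ) ∨ (2 + 1 = j ∧ j ≠ ℓ) ∨ (j = ℓ ∧ 2 + 2 = ℓ) ∨
      (2 = ℓ ∧ j + 2 = ℓ)) := by
      rcases hadj with ⟨h, ⟨h1, h3⟩ | ⟨h1, h3⟩⟩ | ⟨h1, h3⟩
      · exact ⟨h1, h3, h⟩
      · omega
      · omega
    obtain ⟨hjI, rfl, hadj⟩ := hjI
    have gj := g2 j hjI (Ne.symm hij)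
    have fj := hf j hjI
    refine ⟨j, hjI, pairI j hjI (Ne.symm hij) (by omega), rfl, by omega⟩
  right
  rcases hv with ⟨rfl, rfl⟩ | ⟨hj2, rfl⟩
  · have hf2 : 2 ∈ I → f 2 = 2 := by
      intro h
      have := hf 2 h
      omega
    rcases hadj with ⟨h, ⟨h1, rfl⟩ | ⟨h1, rfl⟩⟩ | ⟨h1, rfl⟩
    · have e2 := hf2 h1
      have hi3 : i = 1 ∨ i = 3 ∨ (ℓ = 4 ∧ i = 4) := by omega
      by_cases hex : ∀ y ∈ I, y = 2 ∨ y = i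
      · left
        exact ⟨eq_pair h1 hi hex, hi3⟩
      · push Not at hex
        obtain ⟨y, hy, hy2, hyi⟩ := hex
        have gy := g3 2 h1 y hy (Ne.symm hi2) hyi hy2
        have fy := hf y hy
        have py := hpos y hy
        right
        refine ⟨y, by omega, Or.inr ?_⟩
        refine eq_triple h1 hi hy fun z hz => ?_
        by_contra hcon
        push Not at hcon
        have := g4 2 h1 y hy z hz (Ne.symm hi2) hyi hy2 hcon.2.1 hcon.1 hcon.2.2
        have := hpos z hz
        omega
    · right
      refine ⟨x0, ?_, Or.inl (pairI x0 hx0 hxi0 (by omega))⟩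
      omega
    · have := hf2 h1
      have := g2 2 h1 (Ne.symm hi2)
      omega
  · exfalso
    rcases hadj with ⟨h, ⟨h1, rfl⟩ | ⟨h1, rfl⟩⟩ | ⟨h1, rfl⟩
    · have gj := g2 j h1 (Ne.symm hij)
      have fj := hf j h1
      omega
    · omega
    · omega

theorem rigidD (hT : R.Ty ℓ α (aD ℓ)) (hl : 4 ≤ ℓ) {I : Finset ℕ} (hI : I ⊆ Finset.Icc 1 ℓ)
    (h : R.NonRigid (I.image α) (vec α ℓ (fD ℓ 1))) :
    (∃ k, I = {k}) ∨ I = {1, 2} ∨ (5 ≤ ℓ ∧ I = {2, 3}) ∨ I = {1, ℓ - 1} ∨ I = {1, ℓ} ∨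
      I = {1, 2, ℓ - 1} ∨ I = {1, 2, ℓ} ∨
      (ℓ = 4 ∧ (I = {2, 3} ∨ I = {2, 4} ∨ I = {3, 4} ∨ I = {2, 3, 4})) := by
  rw [hT.nonRigid_iff hI (fD_mem hT hl le_rfl (by omega))] at h
  obtain ⟨i, hi, j, hj, hij, h1, h2⟩ := h
  have hi' := Finset.mem_Icc.1 (hI hi)
  have hj' := Finset.mem_Icc.1 hj
  have hA : aD ℓ j i = if (j + 1 = i ∧ i ≠ ℓ) ∨ (i + 1 = j ∧ j ≠ ℓ) ∨ (j = ℓ ∧ i + 2 = ℓ) ∨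
      (i = ℓ ∧ j + 2 = ℓ) then -1 else 0 := by
    unfold aD; split_ifs <;> omega
  rw [pr_wD hl hi'.1 hi'.2, pr_wD hl hj'.1 hj'.2] at h2
  rw [hA] at h1 h2
  have hf : ∀ i ∈ I, ((i = 1 ∨ i + 1 = ℓ ∨ i = ℓ) ∧ fD ℓ 1 i = 1) ∨
      (i ≠ 1 ∧ i + 1 ≠ ℓ ∧ i ≠ ℓ ∧ fD ℓ 1 i = 2) := by
    intro i hi
    have := Finset.mem_Icc.1 (hI hi)
    unfold fD; split_ifs <;> omega
  have key := rigidD_aux hl hI (fD ℓ 1) hf hi hj' hij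
    (u := if i = 2 then 1 else 0) (v := if j = 2 then 1 else 0) (by split_ifs <;> simp [*])
    (by split_ifs <;> simp [*]) h1 h2 (by
      clear h2 hf
      by_cases hjI : j ∈ I
      · simp only [hjI, if_true, true_and, not_true, false_and, or_false]
        split_ifs with hc
        · left; exact ⟨hc, by norm_num⟩
        · right; norm_num
      · simp only [hjI, if_false, true_and, not_false_iff, false_and, false_or, or_false] at h1 ⊢
        split_ifs at h1 ⊢ with hc
        · exact ⟨hc, by norm_num⟩
        · norm_num at h1)
  clear h1 h2 hA hf
  rcases key with h | ⟨x, -, hx, rfl, rfl | ⟨rfl, rfl | rfl⟩⟩ | ⟨hx, rfl | rfl | ⟨rfl, rfl⟩⟩ |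
    ⟨y, hy, hx⟩
  · exact Or.inl h
  · right; left
    rw [hx, Finset.pair_comm]
  · simp [hx]
  · simp [hx]
  · right; left
    rw [hx, Finset.pair_comm]
  · by_cases h5 : 5 ≤ ℓ
    · right; right; left; exact ⟨h5, hx⟩
    · obtain rfl : ℓ = 4 := by omega
      simp [hx]
  · simp [hx]
  · have p1 : ∀ a b : ℕ, ({2, a, b} : Finset ℕ) = {a, 2, b} := by
      intro a b; exact Finset.insert_comm _ _ _
    have p2 : ∀ a b : ℕ, ({2, a, b} : Finset ℕ) = {b, 2, a} := by
      intro a b; rw [Finset.pair_comm a b]; exact Finset.insert_comm _ _ _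
    rcases hy with ⟨rfl, rfl | rfl⟩ | ⟨rfl, rfl, rfl | rfl⟩ | ⟨rfl, rfl, rfl | rfl⟩ <;>
      rcases hx with hx | hx
    · exact Or.inr (Or.inr (Or.inr (Or.inl (by simpa using hx))))
    · exact Or.inr (Or.inr (Or.inr (Or.inr (Or.inr (Or.inl (by simpa [p1] using hx))))))
    · exact Or.inr (Or.inr (Or.inr (Or.inr (Or.inl hx))))
    · exact Or.inr (Or.inr (Or.inr (Or.inr (Or.inr (Or.inr (Or.inl (hx.trans (p1 _ _))))))))
    · exact Or.inr (Or.inr (Or.inr (Or.inl (hx.trans (Finset.pair_comm _ _)))))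
    · exact Or.inr (Or.inr (Or.inr (Or.inr (Or.inr (Or.inl (hx.trans (p2 _ _)))))))
    · simp [hx]
    · simp [hx]
    · exact Or.inr (Or.inr (Or.inr (Or.inr (Or.inl (hx.trans (Finset.pair_comm _ _))))))
    · exact Or.inr (Or.inr (Or.inr (Or.inr (Or.inr (Or.inr (Or.inl (hx.trans (p2 _ _))))))))
    · rw [Finset.pair_comm] at hx; simp [hx]
    · rw [Finset.pair_comm 4 3] at hx; simp [hx]

end D

end RootSystemBase
namespace GradedLieData
open RootSystemBase
variable {V : Type*} [NormedAddCommGroup V] [InnerProductSpace ℝ V]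
variable {L : Type*} [LieRing L] [LieAlgebra ℂ L] [FiniteDimensional ℂ L]
variable {G : GradedLieData V L} {ℓ : ℕ} {α : ℕ → V}

theorem sum_two {a b : ℕ} (h : a ≠ b) (f : ℕ → ℤ) {n : ℤ} (hn : f a + f b = n) :
    ∑ i ∈ ({a, b} : Finset ℕ), f i = n := by
  rw [Finset.sum_pair h, hn]

theorem sum_three {a b c : ℕ} (h : a ≠ b) (h1 : a ≠ c) (h2 : b ≠ c) (f : ℕ → ℤ) {n : ℤ}
    (hn : f a + f b + f c = n) : ∑ i ∈ ({a, b, c} : Finset ℕ), f i = n := by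
  rw [Finset.sum_insert (by simp [h, h1]), Finset.sum_pair h2, ← hn, add_assoc]

theorem sub_two {a b : ℕ} (h : 1 ≤ a ∧ a ≤ ℓ ∧ 1 ≤ b ∧ b ≤ ℓ) :
    ({a, b} : Finset ℕ) ⊆ Finset.Icc 1 ℓ := by
  intro i hi
  simp only [Finset.mem_insert, Finset.mem_singleton] at hi
  rw [Finset.mem_Icc]
  omega

theorem sub_three {a b c : ℕ} (h : 1 ≤ a ∧ a ≤ ℓ ∧ 1 ≤ b ∧ b ≤ ℓ ∧ 1 ≤ c ∧ c ≤ ℓ) :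
    ({a, b, c} : Finset ℕ) ⊆ Finset.Icc 1 ℓ := by
  intro i hi
  simp only [Finset.mem_insert, Finset.mem_singleton] at hi
  rw [Finset.mem_Icc]
  omega

theorem ex_idx {c d : ℕ → ℤ} (k : ℕ) (h : 1 ≤ k ∧ k ≤ ℓ) (hk : c k ≠ d k) :
    ∃ i ∈ Finset.Icc 1 ℓ, c i ≠ d i := ⟨k, Finset.mem_Icc.2 h, hk⟩

theorem sI_in {i j k : ℕ} (h : i ≤ k ∧ k ≤ j) : sI i j k = 1 := if_pos h
theorem sI_out {i j k : ℕ} (h : ¬ (i ≤ k ∧ k ≤ j)) : sI i j k = 0 := if_neg h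
theorem tD_in {k i : ℕ} (h : (k ≤ i ∧ i + 2 ≤ ℓ) ∨ i = ℓ) : tD ℓ k i = 1 := if_pos h
theorem tD_out {k i : ℕ} (h : ¬ ((k ≤ i ∧ i + 2 ≤ ℓ) ∨ i = ℓ)) : tD ℓ k i = 0 := if_neg h

theorem single_D (hT : G.base.Ty ℓ α (aD ℓ)) (hl : 4 ≤ ℓ)
    (hθ : G.base.IsHighest (vec α ℓ (fD ℓ 1))) {k : ℕ} (h1 : 1 ≤ k) (h2 : k ≤ ℓ) :
    ¬ G.Monge (({k} : Finset ℕ).image α) := by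
  by_cases hk : k = 1 ∨ ℓ < k + 2
  · refine not_monge_single hT hθ (Finset.mem_Icc.2 ⟨h1, h2⟩) ?_
    rcases hk with rfl | hk
    · exact fD_self 1
    · exact fD_end (by omega) hk
  · obtain ⟨m, rfl⟩ : ∃ m, k = m + 1 := ⟨k - 1, by omega⟩
    have hsub : ({m + 1} : Finset ℕ) ⊆ Finset.Icc 1 ℓ := by
      rw [Finset.singleton_subset_iff, Finset.mem_Icc]; omega
    refine not_monge_edges hT hsub (sI (m + 1) (m + 1)) (gD ℓ m) (sI m (m + 1)) (fD ℓ (m + 1))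
      (simple_memD hT (by omega) (by omega)) (gD_mem hT hl (by omega) (by omega))
      (sD_mem hT hl (by omega) (by omega) (by omega)) (fD_mem hT hl (by omega) (by omega))
      (mem_congr (fD_mem hT hl (k := m) (by omega) (by omega)) fun i _ _ => ?_)
      (mem_congr (fD_mem hT hl (k := m) (by omega) (by omega)) fun i _ _ => ?_)
      ?_ ?_ ?_ ?_
      (ex_idx m ⟨by omega, by omega⟩ ?_) (ex_idx ℓ ⟨by omega, by omega⟩ ?_)
      (ex_idx ℓ ⟨by omega, by omega⟩ ?_) (ex_idx m ⟨by omega, by omega⟩ ?_)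
      (ex_idx ℓ ⟨by omega, by omega⟩ ?_) (ex_idx ℓ ⟨by omega, by omega⟩ ?_)
    · rw [Pi.add_apply]; unfold sI gD fD; split_ifs <;> omega
    · rw [Pi.add_apply]; unfold sI fD; split_ifs <;> omega
    · rw [Finset.sum_singleton]; unfold sI; split_ifs <;> omega
    · rw [Finset.sum_singleton]; unfold gD; split_ifs <;> omega
    · rw [Finset.sum_singleton]; unfold sI; split_ifs <;> omega
    · rw [Finset.sum_singleton]; unfold fD; split_ifs <;> omega
    · unfold sI; split_ifs <;> omega
    · unfold sI fD; split_ifs <;> omega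
    · unfold sI gD; split_ifs <;> omega
    · unfold gD fD; split_ifs <;> omega
    · unfold sI gD; split_ifs <;> omega
    · unfold sI fD; split_ifs <;> omega

theorem two_three_D (hT : G.base.Ty ℓ α (aD ℓ)) (hl : 5 ≤ ℓ) :
    ¬ G.Monge (({2, 3} : Finset ℕ).image α) := by
  have hl4 : 4 ≤ ℓ := by omega
  refine not_monge_edges hT (sub_two (by omega)) (sI 2 2) (sI 3 3) (sI 1 2) (sI 3 4)
    (sD_mem hT hl4 (by omega) (by omega) (by omega))
    (sD_mem hT hl4 (by omega) (by omega) (by omega))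
    (sD_mem hT hl4 (by omega) (by omega) (by omega))
    (sD_mem hT hl4 (by omega) (by omega) (by omega))
    (mem_congr (sD_mem hT hl4 (i := 2) (j := 3) (by omega) (by omega) (by omega))
      fun i _ _ => ?_)
    (mem_congr (sD_mem hT hl4 (i := 1) (j := 4) (by omega) (by omega) (by omega))
      fun i _ _ => ?_)
    (sum_two (by omega) _ (by decide)) (sum_two (by omega) _ (by decide))
    (sum_two (by omega) _ (by decide)) (sum_two (by omega) _ (by decide))
    (ex_idx 1 (by omega) (by decide)) (ex_idx 2 (by omega) (by decide))
    (ex_idx 1 (by omega) (by decide)) (ex_idx 4 (by omega) (by decide))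
    (ex_idx 2 (by omega) (by decide)) (ex_idx 1 (by omega) (by decide))
  · rw [Pi.add_apply]; unfold sI; split_ifs <;> omega
  · rw [Pi.add_apply]; unfold sI; split_ifs <;> omega

theorem one_pred_D (hT : G.base.Ty ℓ α (aD ℓ)) (hl : 4 ≤ ℓ) :
    ¬ G.Monge (({1, ℓ - 1} : Finset ℕ).image α) := by
  refine not_monge_edges hT (sub_two (by omega)) (sI 1 1) (sI 2 (ℓ - 1)) (sI 1 (ℓ - 2))
    (sI (ℓ - 1) (ℓ - 1))
    (sD_mem hT hl (by omega) (by omega) (by omega))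
    (sD_mem hT hl (by omega) (by omega) (by omega))
    (sD_mem hT hl (by omega) (by omega) (by omega))
    (sD_mem hT hl (by omega) (by omega) (by omega))
    (mem_congr (sD_mem hT hl (i := 1) (j := ℓ - 1) (by omega) (by omega) (by omega))
      fun i _ _ => ?_)
    (mem_congr (sD_mem hT hl (i := 1) (j := ℓ - 1) (by omega) (by omega) (by omega))
      fun i _ _ => ?_)
    (sum_two (by omega) _ ?_) (sum_two (by omega) _ ?_)
    (sum_two (by omega) _ ?_) (sum_two (by omega) _ ?_)
    (ex_idx 2 (by omega) ?_) (ex_idx 1 (by omega) ?_)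
    (ex_idx 1 (by omega) ?_) (ex_idx 2 (by omega) ?_)
    (ex_idx 1 (by omega) ?_) (ex_idx 1 (by omega) ?_)
  · rw [Pi.add_apply]; unfold sI; split_ifs <;> omega
  · rw [Pi.add_apply]; unfold sI; split_ifs <;> omega
  all_goals unfold sI; split_ifs <;> omega

theorem one_last_D (hT : G.base.Ty ℓ α (aD ℓ)) (hl : 4 ≤ ℓ) :
    ¬ G.Monge (({1, ℓ} : Finset ℕ).image α) := by
  refine not_monge_edges hT (sub_two (by omega)) (sI 1 1) (tD ℓ 2) (sI 1 (ℓ - 2))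
    (sI ℓ ℓ)
    (sD_mem hT hl (by omega) (by omega) (by omega))
    (tD_mem hT hl (by omega) (by omega))
    (sD_mem hT hl (by omega) (by omega) (by omega))
    (simple_memD hT (by omega) (by omega))
    (mem_congr (tD_mem hT hl (k := 1) (by omega) (by omega)) fun i _ _ => ?_)
    (mem_congr (tD_mem hT hl (k := 1) (by omega) (by omega)) fun i _ _ => ?_)
    (sum_two (by omega) _ ?_) (sum_two (by omega) _ ?_)
    (sum_two (by omega) _ ?_) (sum_two (by omega) _ ?_)
    (ex_idx 2 (by omega) ?_) (ex_idx 1 (by omega) ?_)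
    (ex_idx 1 (by omega) ?_) (ex_idx 2 (by omega) ?_)
    (ex_idx 1 (by omega) ?_) (ex_idx 1 (by omega) ?_)
  · rw [Pi.add_apply]; unfold sI tD; split_ifs <;> omega
  · rw [Pi.add_apply]; unfold sI tD; split_ifs <;> omega
  all_goals first | (unfold sI tD; split_ifs <;> omega) | (unfold sI; split_ifs <;> omega) |
    (unfold tD; split_ifs <;> omega)

theorem one_two_pred_D (hT : G.base.Ty ℓ α (aD ℓ)) (hl : 4 ≤ ℓ) :
    ¬ G.Monge (({1, 2, ℓ - 1} : Finset ℕ).image α) := by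
  refine not_monge_edges hT (sub_three (by omega)) (sI 1 1) (sI 2 2) (tD ℓ 2)
    (sI (ℓ - 1) (ℓ - 1))
    (sD_mem hT hl (by omega) (by omega) (by omega))
    (sD_mem hT hl (by omega) (by omega) (by omega))
    (tD_mem hT hl (by omega) (by omega))
    (simple_memD hT (by omega) (by omega))
    (mem_congr (sD_mem hT hl (i := 1) (j := 2) (by omega) (by omega) (by omega))
      fun i _ _ => ?_)
    (mem_congr (sD_mem' hT hl (k := 2) (by omega) (by omega)) fun i _ _ => ?_)
    (sum_three (by omega) (by omega) (by omega) _ ?_)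
    (sum_three (by omega) (by omega) (by omega) _ ?_)
    (sum_three (by omega) (by omega) (by omega) _ ?_)
    (sum_three (by omega) (by omega) (by omega) _ ?_)
    (ex_idx 1 (by omega) ?_) (ex_idx 1 (by omega) ?_)
    (ex_idx ℓ (by omega) ?_) (ex_idx 2 (by omega) ?_)
    (ex_idx 1 (by omega) ?_) (ex_idx 2 (by omega) ?_)
  · rw [Pi.add_apply]; unfold sI; split_ifs <;> omega
  · rw [Pi.add_apply]; unfold sI tD; split_ifs <;> omega
  all_goals first | (unfold sI tD; split_ifs <;> omega) | (unfold sI; split_ifs <;> omega) |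
    (unfold tD; split_ifs <;> omega)

theorem one_two_last_D (hT : G.base.Ty ℓ α (aD ℓ)) (hl : 4 ≤ ℓ) :
    ¬ G.Monge (({1, 2, ℓ} : Finset ℕ).image α) := by
  refine not_monge_edges hT (sub_three (by omega)) (sI 1 1) (sI 2 2) (sI 2 (ℓ - 1))
    (sI ℓ ℓ)
    (sD_mem hT hl (by omega) (by omega) (by omega))
    (sD_mem hT hl (by omega) (by omega) (by omega))
    (sD_mem hT hl (by omega) (by omega) (by omega))
    (simple_memD hT (by omega) (by omega))
    (mem_congr (sD_mem hT hl (i := 1) (j := 2) (by omega) (by omega) (by omega))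
      fun i _ _ => ?_)
    (mem_congr (sD_mem' hT hl (k := 2) (by omega) (by omega)) fun i _ _ => ?_)
    (sum_three (by omega) (by omega) (by omega) _ ?_)
    (sum_three (by omega) (by omega) (by omega) _ ?_)
    (sum_three (by omega) (by omega) (by omega) _ ?_)
    (sum_three (by omega) (by omega) (by omega) _ ?_)
    (ex_idx 1 (by omega) ?_) (ex_idx 1 (by omega) ?_)
    (ex_idx (ℓ - 1) (by omega) ?_) (ex_idx 2 (by omega) ?_)
    (ex_idx 1 (by omega) ?_) (ex_idx 2 (by omega) ?_)
  · rw [Pi.add_apply]; unfold sI; split_ifs <;> omega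
  · rw [Pi.add_apply]; unfold sI; split_ifs <;> omega
  all_goals unfold sI; split_ifs <;> omega

theorem three_four_D (hT : G.base.Ty 4 α (aD 4)) :
    ¬ G.Monge (({3, 4} : Finset ℕ).image α) := by
  refine not_monge_edges hT (by decide) (sI 3 3) (tD 4 2) (sI 2 3) (sI 4 4)
    (simple_memD hT (by omega) (by omega))
    (tD_mem hT (by omega) (by omega) (by omega))
    (sD_mem hT (by omega) (by omega) (by omega) (by omega))
    (simple_memD hT (by omega) (by omega))
    (mem_congr (sD_mem' hT (by omega) (k := 2) (by omega) (by omega)) fun i _ _ => ?_)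
    (mem_congr (sD_mem' hT (by omega) (k := 2) (by omega) (by omega)) fun i _ _ => ?_)
    (sum_two (by omega) _ (by decide)) (sum_two (by omega) _ (by decide))
    (sum_two (by omega) _ (by decide)) (sum_two (by omega) _ (by decide))
    (ex_idx 2 (by omega) (by decide)) (ex_idx 3 (by omega) (by decide))
    (ex_idx 3 (by omega) (by decide)) (ex_idx 2 (by omega) (by decide))
    (ex_idx 3 (by omega) (by decide)) (ex_idx 2 (by omega) (by decide))
  · rw [Pi.add_apply]; unfold sI tD; split_ifs <;> omega
  · rw [Pi.add_apply]; unfold sI; split_ifs <;> omega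

theorem two_three_four_D (hT : G.base.Ty 4 α (aD 4)) :
    ¬ G.Monge (({2, 3, 4} : Finset ℕ).image α) := by
  refine not_monge_edges hT (by decide) (sI 2 2) (sI 3 3) (sI 1 2) (sI 4 4)
    (simple_memD hT (by omega) (by omega))
    (simple_memD hT (by omega) (by omega))
    (sD_mem hT (by omega) (by omega) (by omega) (by omega))
    (simple_memD hT (by omega) (by omega))
    (mem_congr (sD_mem hT (by omega) (i := 2) (j := 3) (by omega) (by omega) (by omega))
      fun i _ _ => ?_)
    (mem_congr (tD_mem hT (by omega) (k := 1) (by omega) (by omega)) fun i _ _ => ?_)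
    (sum_three (by omega) (by omega) (by omega) _ (by decide))
    (sum_three (by omega) (by omega) (by omega) _ (by decide))
    (sum_three (by omega) (by omega) (by omega) _ (by decide))
    (sum_three (by omega) (by omega) (by omega) _ (by decide))
    (ex_idx 1 (by omega) (by decide)) (ex_idx 2 (by omega) (by decide))
    (ex_idx 1 (by omega) (by decide)) (ex_idx 3 (by omega) (by decide))
    (ex_idx 2 (by omega) (by decide)) (ex_idx 1 (by omega) (by decide))
  · rw [Pi.add_apply]; unfold sI; split_ifs <;> omega
  · rw [Pi.add_apply]; unfold sI tD; split_ifs <;> omega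

/-- In type D the set `{α₁, α₂}` gives a non-rigid Monge grading. -/
theorem one_two_D (hT : G.base.Ty ℓ α (aD ℓ)) (hl : 4 ≤ ℓ) {θ : V} (hθ : G.base.IsHighest θ) :
    G.Monge (({1, 2} : Finset ℕ).image α) ∧
      G.base.NonRigid (({1, 2} : Finset ℕ).image α) θ := by
  obtain rfl := highestD hT hl hθ
  refine ⟨monge_one_two hT (by omega) hθ (fD_self 1) fun c => ?_, ?_⟩
  · rw [prD hl c (by omega) (by omega), if_neg (by omega), if_pos (by omega), if_neg (by omega),
      if_neg (by omega)]
    ring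
  · have hI : ({1, 2} : Finset ℕ) ⊆ Finset.Icc 1 ℓ := sub_two (by omega)
    rw [hT.nonRigid_iff hI (fD_mem hT hl (by omega) (by omega))]
    have ha : aD ℓ 2 1 = -1 := by
      unfold aD
      split_ifs <;> omega
    refine ⟨1, by simp, 2, Finset.mem_Icc.2 (by omega), by omega, ?_, ?_⟩
    · rw [ha]; simp
    · rw [ha, pr_wD hl (by omega) (by omega), pr_wD hl (by omega) (by omega),
        Finset.sum_pair (by omega), fD_self, fD_mid (by omega) (by omega)]
      simp

theorem ty_D {R : RootSystemBase V} (hT : R.IsTypeOf ℓ α (matD ℓ)) (hl : 4 ≤ ℓ) :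
    R.Ty ℓ α (aD ℓ) :=
  ⟨hT.1, hT.2.1, fun i hi j hj => by rw [hT.2.2 i hi j hj, matD_eq hl hi hj]⟩

theorem ty_B {R : RootSystemBase V} (hT : R.IsTypeOf ℓ α (matB ℓ)) :
    R.Ty ℓ α (aB ℓ) :=
  ⟨hT.1, hT.2.1, fun i hi j hj => by rw [hT.2.2 i hi j hj, matB_eq ℓ hi hj]⟩

theorem relabel {R : RootSystemBase V} {M : ℕ → ℕ → ℝ} (hT : R.IsTypeOf ℓ α M)
    (π : Equiv.Perm ℕ) (hπ : Set.MapsTo π (Set.Icc 1 ℓ) (Set.Icc 1 ℓ))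
    (hM : ∀ i ∈ Finset.Icc 1 ℓ, ∀ j ∈ Finset.Icc 1 ℓ, M (π i) (π j) = M i j) :
    R.IsTypeOf ℓ (fun i => α (π i)) M := by
  have hm : ∀ i ∈ Finset.Icc 1 ℓ, π i ∈ Finset.Icc 1 ℓ := by
    intro i hi
    have := hπ (Finset.mem_Icc.1 hi)
    exact Finset.mem_Icc.2 this
  have himg : (Finset.Icc 1 ℓ).image π = Finset.Icc 1 ℓ := by
    apply Finset.eq_of_subset_of_card_le
    · intro i hi
      obtain ⟨j, hj, rfl⟩ := Finset.mem_image.1 hi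
      exact hm j hj
    · rw [Finset.card_image_of_injective _ π.injective]
  refine ⟨?_, ?_, ?_⟩
  · intro i hi j hj h
    exact π.injective (hT.1 (hπ hi) (hπ hj) h)
  · rw [hT.2.1]
    conv_lhs => rw [← himg]
    rw [Finset.image_image]
    rfl
  · intro i hi j hj
    rw [← hM i hi j hj]
    exact hT.2.2 _ (hm i hi) _ (hm j hj)

theorem mainD (hT : G.base.IsTypeOf ℓ α (matD ℓ)) (hl : 4 ≤ ℓ) {θ : V}
    (hθ : G.base.IsHighest θ) {S : Finset V} (hS : S ⊆ G.base.Δ0) :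
    (G.Monge S ∧ G.base.NonRigid S θ) ↔
        ∃ π : Equiv.Perm ℕ, Set.MapsTo π (Set.Icc 1 ℓ) (Set.Icc 1 ℓ) ∧
          (∀ i ∈ Finset.Icc 1 ℓ, ∀ j ∈ Finset.Icc 1 ℓ,
            RootSystemBase.matD ℓ (π i) (π j) = RootSystemBase.matD ℓ i j) ∧
          S = {α (π 1), α (π 2)} := by
  constructor
  · rintro ⟨hM, hN⟩
    have hT' := ty_D hT hl
    obtain ⟨I, hI, rfl⟩ := hT'.exists_image hS
    obtain rfl := highestD hT' hl hθ
    rcases rigidD hT' hl hI hN with ⟨k, rfl⟩ | rfl | ⟨h5, rfl⟩ | rfl | rfl | rfl | rfl |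
      ⟨rfl, rfl | rfl | rfl | rfl⟩
    · have := Finset.mem_Icc.1 (hI (Finset.mem_singleton_self k))
      exact absurd hM (single_D hT' hl hθ this.1 this.2)
    · refine ⟨Equiv.refl ℕ, fun _ h => h, fun _ _ _ _ => rfl, ?_⟩
      simp [Finset.image_insert]
    · exact absurd hM (two_three_D hT' h5)
    · exact absurd hM (one_pred_D hT' hl)
    · exact absurd hM (one_last_D hT' hl)
    · exact absurd hM (one_two_pred_D hT' hl)
    · exact absurd hM (one_two_last_D hT' hl)
    · refine ⟨Equiv.swap 1 3, ?_, ?_, ?_⟩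
      · rintro i ⟨h1, h2⟩
        interval_cases i <;> simp [Equiv.swap_apply_def]
      · intro i hi j hj
        rw [Finset.mem_Icc] at hi hj
        obtain ⟨h1, h2⟩ := hi
        obtain ⟨h3, h4⟩ := hj
        interval_cases i <;> interval_cases j <;> simp [Equiv.swap_apply_def, matD]
      · rw [Equiv.swap_apply_left, Equiv.swap_apply_of_ne_of_ne (by omega) (by omega),
          Finset.image_insert, Finset.image_singleton, Finset.pair_comm]
    · refine ⟨Equiv.swap 1 4, ?_, ?_, ?_⟩
      · rintro i ⟨h1, h2⟩
        interval_cases i <;> simp [Equiv.swap_apply_def]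
      · intro i hi j hj
        rw [Finset.mem_Icc] at hi hj
        obtain ⟨h1, h2⟩ := hi
        obtain ⟨h3, h4⟩ := hj
        interval_cases i <;> interval_cases j <;> simp [Equiv.swap_apply_def, matD]
      · rw [Equiv.swap_apply_left, Equiv.swap_apply_of_ne_of_ne (by omega) (by omega),
          Finset.image_insert, Finset.image_singleton, Finset.pair_comm]
    · exact absurd hM (three_four_D hT')
    · exact absurd hM (two_three_four_D hT')
  · rintro ⟨π, h1, h2, rfl⟩
    have := one_two_D (ty_D (relabel hT π h1 h2) hl) hl hθ
    rwa [Finset.image_insert, Finset.image_singleton] at this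

end GradedLieData

/-- (a) For a complex simple Lie algebra of type `Bₗ`, `ℓ ≥ 2`,
with simple roots `α 1, …, α ℓ` (standard ordering): every Monge grading with
`|Σ| = 3` and `ℓ ≥ 4` is rigid, and the non-rigid Monge gradings are exactly
`B₂{α₂}`, `B₃{α₂,α₃}`, `B₃{α₁,α₂,α₃}` and `Bₗ{α₁,α₂}` for `ℓ ≥ 2`.
(b) For a complex simple Lie algebra of type `Dₗ`, `ℓ ≥ 4`: every Monge grading with
`|Σ| ≥ 3` is rigid, and, up to automorphisms of the Dynkin diagram, the non-rigid
Monge gradings are exactly `Σ = {α₁, α₂}`. -/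
theorem statement15 {V₁ : Type*} [NormedAddCommGroup V₁] [InnerProductSpace ℝ V₁]
    {L₁ : Type*} [LieRing L₁] [LieAlgebra ℂ L₁] [FiniteDimensional ℂ L₁]
    (G₁ : GradedLieData V₁ L₁)
    (ℓ₁ : ℕ) (hl₁ : 2 ≤ ℓ₁) (α₁ : ℕ → V₁)
    (hB : G₁.base.IsTypeOf ℓ₁ α₁ (RootSystemBase.matB ℓ₁))
    (Sg₁ : Finset V₁) (hSg₁ : Sg₁ ⊆ G₁.base.Δ0) (hne₁ : Sg₁.Nonempty)
    (θ₁ : V₁) (hθ₁ : G₁.base.IsHighest θ₁)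
    {V₂ : Type*} [NormedAddCommGroup V₂] [InnerProductSpace ℝ V₂]
    {L₂ : Type*} [LieRing L₂] [LieAlgebra ℂ L₂] [FiniteDimensional ℂ L₂]
    (G₂ : GradedLieData V₂ L₂)
    (ℓ₂ : ℕ) (hl₂ : 4 ≤ ℓ₂) (α₂ : ℕ → V₂)
    (hD : G₂.base.IsTypeOf ℓ₂ α₂ (RootSystemBase.matD ℓ₂))
    (Sg₂ : Finset V₂) (hSg₂ : Sg₂ ⊆ G₂.base.Δ0) (hne₂ : Sg₂.Nonempty)
    (θ₂ : V₂) (hθ₂ : G₂.base.IsHighest θ₂) :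
    -- (a) type B
    ((4 ≤ ℓ₁ → Sg₁.card = 3 → G₁.Monge Sg₁ → ¬ G₁.base.NonRigid Sg₁ θ₁) ∧
     ((G₁.Monge Sg₁ ∧ G₁.base.NonRigid Sg₁ θ₁) ↔
        ((ℓ₁ = 2 ∧ Sg₁ = {α₁ 2}) ∨ (ℓ₁ = 3 ∧ Sg₁ = {α₁ 2, α₁ 3}) ∨
         (ℓ₁ = 3 ∧ Sg₁ = {α₁ 1, α₁ 2, α₁ 3}) ∨ Sg₁ = {α₁ 1, α₁ 2}))) ∧
    -- (b) type D
    ((3 ≤ Sg₂.card → G₂.Monge Sg₂ → ¬ G₂.base.NonRigid Sg₂ θ₂) ∧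
     ((G₂.Monge Sg₂ ∧ G₂.base.NonRigid Sg₂ θ₂) ↔
        ∃ π : Equiv.Perm ℕ, Set.MapsTo π (Set.Icc 1 ℓ₂) (Set.Icc 1 ℓ₂) ∧
          (∀ i ∈ Finset.Icc 1 ℓ₂, ∀ j ∈ Finset.Icc 1 ℓ₂,
            RootSystemBase.matD ℓ₂ (π i) (π j) = RootSystemBase.matD ℓ₂ i j) ∧
          Sg₂ = {α₂ (π 1), α₂ (π 2)})) := by
  have hmem : ∀ k, 1 ≤ k ∧ k ≤ ℓ₁ → k ∈ Finset.Icc 1 ℓ₁ := fun k h => Finset.mem_Icc.2 h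
  have hBmain : (G₁.Monge Sg₁ ∧ G₁.base.NonRigid Sg₁ θ₁) ↔
        ((ℓ₁ = 2 ∧ Sg₁ = {α₁ 2}) ∨ (ℓ₁ = 3 ∧ Sg₁ = {α₁ 2, α₁ 3}) ∨
         (ℓ₁ = 3 ∧ Sg₁ = {α₁ 1, α₁ 2, α₁ 3}) ∨ Sg₁ = {α₁ 1, α₁ 2}) := by
    have hT := GradedLieData.ty_B hB
    obtain ⟨I, hI, rfl⟩ := hT.exists_image hSg₁
    have e1 : ({α₁ 2} : Finset V₁) = ({2} : Finset ℕ).image α₁ := by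
      rw [Finset.image_singleton]
    have e2 : ({α₁ 2, α₁ 3} : Finset V₁) = ({2, 3} : Finset ℕ).image α₁ := by
      rw [Finset.image_insert, Finset.image_singleton]
    have e3 : ({α₁ 1, α₁ 2, α₁ 3} : Finset V₁) = ({1, 2, 3} : Finset ℕ).image α₁ := by
      rw [Finset.image_insert, Finset.image_insert, Finset.image_singleton]
    have e4 : ({α₁ 1, α₁ 2} : Finset V₁) = ({1, 2} : Finset ℕ).image α₁ := by
      rw [Finset.image_insert, Finset.image_singleton]
    rw [GradedLieData.mainB hT hl₁ hθ₁ hI (Finset.image_nonempty.1 hne₁), e3, e4, e2, e1]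
    refine or_congr (and_congr_right fun h => ?_) (or_congr (and_congr_right fun h => ?_)
      (or_congr (and_congr_right fun h => ?_) ?_))
    · rw [hT.image_inj hI (Finset.singleton_subset_iff.2 (hmem 2 (by omega)))]
    · rw [hT.image_inj hI (GradedLieData.sub_two (by omega))]
    · rw [hT.image_inj hI (GradedLieData.sub_three (by omega))]
    · rw [hT.image_inj hI (GradedLieData.sub_two (by omega))]
  have hDmain := GradedLieData.mainD (G := G₂) hD hl₂ hθ₂ hSg₂
  refine ⟨⟨fun h4 hc hM hN => ?_, hBmain⟩, ⟨fun hc hM hN => ?_, hDmain⟩⟩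
  · rcases hBmain.1 ⟨hM, hN⟩ with ⟨h, -⟩ | ⟨h, -⟩ | ⟨h, -⟩ | h
    · omega
    · omega
    · omega
    · have := Finset.card_le_two (a := α₁ 1) (b := α₁ 2)
      rw [← h] at this
      omega
  · obtain ⟨π, -, -, h⟩ := hDmain.1 ⟨hM, hN⟩
    have := Finset.card_le_two (a := α₂ (π 1)) (b := α₂ (π 2))
    rw [← h] at this
    omega
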